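/- arXiv:1410.1910 — 7 statements merged into one kernel-verified Lean document; each statement's English description precedes it below -/
import Mathlib

section
/- For every positive integer n, the ideal P_2 generated by the principal 2-minors of the generic n×n matrix X is a prime ideal of S = K[X]; equivalently, the quotient ring K[X]/P_2 is an integral domain. -/
open Matrix

/-- The generic `n × n` matrix whose entries are the variables `x i j` of the
polynomial ring `K[X]`. -/
noncomputable def genMat (K : Type*) [Field K] (n : ℕ) :
    Matrix (Fin n) (Fin n) (MvPolynomial (Fin n × Fin n) K) :=
  fun i j => MvPolynomial.X (i, j)

/-- `P_t`: the ideal generated by the principal `t`-minors of the generic matrix,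
i.e. the determinants of the submatrices whose rows and columns are both indexed by
a subset `s` of cardinality `t`. -/
noncomputable def prinMinorIdeal (K : Type*) [Field K] (n t : ℕ) :
    Ideal (MvPolynomial (Fin n × Fin n) K) :=
  Ideal.span {p | ∃ s : Finset (Fin n), s.card = t ∧
    p = ((genMat K n).submatrix (fun i : {x // x ∈ s} => (i : Fin n))
        (fun j : {x // x ∈ s} => (j : Fin n))).det}

section

open MvPolynomial

/-- The exponent map of the monomial parametrization whose kernel is `P₂`: the sums of the
`i`-th row and the `i`-th column, and the skew-symmetric part of the exponent matrix. -/
def exponentMap (n : ℕ) :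
    (Fin n × Fin n →₀ ℕ) →+ (Fin n → ℤ) × (Fin n × Fin n → ℤ) where
  toFun a := (fun i => ∑ k, ((a (i, k) : ℤ) + a (k, i)), fun p => (a p : ℤ) - a p.swap)
  map_zero' := by ext <;> simp
  map_add' a b := by
    ext i
    · simp only [Finsupp.add_apply, Nat.cast_add, Prod.fst_add, Pi.add_apply,
        ← Finset.sum_add_distrib]
      exact Finset.sum_congr rfl fun k _ => by ring
    · simp only [Finsupp.add_apply, Nat.cast_add, Prod.snd_add, Pi.add_apply]
      ring

lemma exponentMap_diag_add_diag {n : ℕ} (i j : Fin n) :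
    exponentMap n (Finsupp.single (i, i) 1 + Finsupp.single (j, j) 1) =
      exponentMap n (Finsupp.single (i, j) 1 + Finsupp.single (j, i) 1) := by
  ext k
  · simp only [exponentMap, AddMonoidHom.coe_mk, ZeroHom.coe_mk, Finsupp.add_apply,
      Finsupp.single_apply, Prod.mk.injEq, Nat.cast_add, Nat.cast_ite, Nat.cast_one,
      Nat.cast_zero, Finset.sum_add_distrib, ite_and, Finset.sum_ite_irrel, Finset.sum_ite_eq,
      Finset.mem_univ, if_true, Finset.sum_const_zero]
    ring
  · obtain ⟨k, l⟩ := k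
    simp only [exponentMap, AddMonoidHom.coe_mk, ZeroHom.coe_mk, Finsupp.add_apply,
      Finsupp.single_apply, Prod.mk.injEq, Prod.swap_prod_mk, Nat.cast_add, Nat.cast_ite,
      Nat.cast_one, Nat.cast_zero]
    grind

/-- Exponents of monomials divisible by no product `x i j * x j i` with `i ≠ j`. -/
def IsReducedExponent {n : ℕ} (a : Fin n × Fin n →₀ ℕ) : Prop :=
  ∀ i j, i ≠ j → a (i, j) = 0 ∨ a (j, i) = 0

lemma IsReducedExponent.eq_of_exponentMap_eq {n : ℕ} {a b : Fin n × Fin n →₀ ℕ}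
    (ha : IsReducedExponent a) (hb : IsReducedExponent b) (h : exponentMap n a = exponentMap n b) : a = b := by
  have off : ∀ i j, i ≠ j → a (i, j) = b (i, j) := by
    intro i j hij
    have h2 : (a (i, j) : ℤ) - a (j, i) = b (i, j) - b (j, i) :=
      congrFun (congrArg Prod.snd h) (i, j)
    have := ha i j hij
    have := hb i j hij
    omega
  ext ⟨i, j⟩
  by_cases hij : i = j
  · subst hij
    have h1 : ∑ k, ((a (i, k) : ℤ) + a (k, i)) = ∑ k, ((b (i, k) : ℤ) + b (k, i)) :=
      congrFun (congrArg Prod.fst h) i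
    rw [← Finset.add_sum_erase _ _ (Finset.mem_univ i),
      ← Finset.add_sum_erase (a := i) _ _ (Finset.mem_univ i),
      Finset.sum_congr rfl fun k hk => by
        rw [off i k (Finset.ne_of_mem_erase hk).symm, off k i (Finset.ne_of_mem_erase hk)]] at h1
    have := add_right_cancel h1
    omega
  · exact off i j hij

lemma det_genMat_submatrix_pair (K : Type*) [Field K] {n : ℕ} {i j : Fin n} (hij : i ≠ j) :
    ((genMat K n).submatrix (fun k : {x // x ∈ ({i, j} : Finset (Fin n))} => (k : Fin n))
        (fun k : {x // x ∈ ({i, j} : Finset (Fin n))} => (k : Fin n))).det =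
      X (i, i) * X (j, j) - X (i, j) * X (j, i) := by
  let e : Fin 2 ≃ {x // x ∈ ({i, j} : Finset (Fin n))} :=
    Equiv.ofBijective ![⟨i, by simp⟩, ⟨j, by simp⟩] <| by
      constructor
      · intro k l
        fin_cases k <;> fin_cases l <;> simp [hij, hij.symm]
      · rintro ⟨k, hk⟩
        rcases Finset.mem_insert.1 hk with rfl | hk
        · exact ⟨0, rfl⟩
        · exact ⟨1, Subtype.ext (Finset.mem_singleton.1 hk).symm⟩
  rw [← Matrix.det_submatrix_equiv_self e, Matrix.det_fin_two]
  rfl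

lemma binomial_mem_prinMinorIdeal (K : Type*) [Field K] {n : ℕ} {i j : Fin n} (hij : i ≠ j) :
    X (i, i) * X (j, j) - X (i, j) * X (j, i) ∈ prinMinorIdeal K n 2 :=
  Ideal.subset_span ⟨{i, j}, Finset.card_pair hij, (det_genMat_submatrix_pair K hij).symm⟩

lemma exists_isReducedExponent_sub_mem (K : Type*) [Field K] {n : ℕ} (a : Fin n × Fin n →₀ ℕ) :
    ∃ b, IsReducedExponent b ∧ exponentMap n b = exponentMap n a ∧
      monomial a (1 : K) - monomial b 1 ∈ prinMinorIdeal K n 2 := by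
  induction h : ∑ p with p.1 ≠ p.2, a p using Nat.strong_induction_on generalizing a with
  | _ m ih =>
    subst h
    by_cases ha : IsReducedExponent a
    · exact ⟨a, ha, rfl, by simp⟩
    · simp only [IsReducedExponent, not_forall, not_or] at ha
      obtain ⟨i, j, hij, h1, h2⟩ := ha
      obtain ⟨c, rfl⟩ : ∃ c, a = c + (Finsupp.single (i, j) 1 + Finsupp.single (j, i) 1) := by
        refine le_iff_exists_add'.1 fun p => ?_
        simp only [Finsupp.add_apply, Finsupp.single_apply]
        grind
      have h3 : ∀ k : Fin n, ∑ p : Fin n × Fin n with p.1 ≠ p.2,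
          Finsupp.single (k, k) 1 p = 0 := fun k =>
        Finset.sum_eq_zero fun p hp => Finsupp.single_eq_of_ne <| by
          rintro rfl
          simp at hp
      have h4 : 0 < ∑ p : Fin n × Fin n with p.1 ≠ p.2, Finsupp.single (i, j) 1 p :=
        Finset.sum_pos' (fun _ _ => Nat.zero_le _) ⟨(i, j), by simpa using hij, by simp⟩
      obtain ⟨b, hb, hba, hmem⟩ :=
        ih _ (by simp only [Finsupp.add_apply, Finset.sum_add_distrib, h3]; omega)
          (c + (Finsupp.single (i, i) 1 + Finsupp.single (j, j) 1)) rfl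
      refine ⟨b, hb, ?_, ?_⟩
      · rw [hba, map_add _ c, map_add _ c, exponentMap_diag_add_diag]
      · have := (prinMinorIdeal K n 2).sub_mem hmem
          ((prinMinorIdeal K n 2).mul_mem_left (monomial c 1) (binomial_mem_prinMinorIdeal K hij))
        convert this using 1
        simp only [X, mul_sub, monomial_mul, mul_one]
        ring

/-- The monomial parametrization of the variety of `P₂`, as a map to a Laurent polynomial ring. -/
noncomputable def monomialMap (K : Type*) [Field K] (n : ℕ) :
    MvPolynomial (Fin n × Fin n) K →+*
      AddMonoidAlgebra K ((Fin n → ℤ) × (Fin n × Fin n → ℤ)) :=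
  AddMonoidAlgebra.mapDomainRingHom K (exponentMap n)

lemma monomialMap_monomial {K : Type*} [Field K] {n : ℕ} (a : Fin n × Fin n →₀ ℕ) (c : K) :
    monomialMap K n (monomial a c) = AddMonoidAlgebra.single (exponentMap n a) c :=
  AddMonoidAlgebra.mapDomain_single

lemma prinMinorIdeal_two_eq_ker (K : Type*) [Field K] (n : ℕ) :
    prinMinorIdeal K n 2 = RingHom.ker (monomialMap K n) := by
  apply le_antisymm
  · rw [prinMinorIdeal, Ideal.span_le]
    rintro _ ⟨s, hs, rfl⟩
    obtain ⟨i, j, hij, rfl⟩ := Finset.card_eq_two.1 hs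
    rw [det_genMat_submatrix_pair K hij, SetLike.mem_coe, RingHom.mem_ker]
    simp only [X, monomial_mul, map_sub, monomialMap_monomial, exponentMap_diag_add_diag, sub_self]
  · intro p hp
    choose N hN hfN hmem using exists_isReducedExponent_sub_mem K (n := n)
    have hfac : N.FactorsThrough (exponentMap n) := fun a b hab =>
      (hN a).eq_of_exponentMap_eq (hN b) (by rw [hfN, hfN, hab])
    let g := Function.extend (exponentMap n) N 0
    have hg : ∀ q, q - AddMonoidAlgebra.mapDomain g (monomialMap K n q) ∈
        prinMinorIdeal K n 2 := by
      intro q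
      induction q using MvPolynomial.induction_on' with
      | monomial a c =>
        have := (prinMinorIdeal K n 2).mul_mem_left (C c) (hmem a)
        rw [monomialMap_monomial, AddMonoidAlgebra.mapDomain_single,
          show g (exponentMap n a) = N a from hfac.extend_apply 0 a]
        rwa [mul_sub, C_mul_monomial, C_mul_monomial, mul_one] at this
      | add q r hq hr =>
        rw [map_add, AddMonoidAlgebra.mapDomain_add, add_sub_add_comm]
        exact add_mem hq hr
    have h := hg p
    rwa [RingHom.mem_ker.1 hp, AddMonoidAlgebra.mapDomain_zero, sub_zero] at h

end

/-- For every positive integer `n`, the ideal `P₂` generated by the principal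
2-minors of the generic `n × n` matrix is a prime ideal of `K[X]`; equivalently,
the quotient ring `K[X]/P₂` is an integral domain. -/
theorem prinMinorIdeal_two_isPrime (K : Type*) [Field K] [IsAlgClosed K]
    (n : ℕ) (hn : 0 < n) :
    (prinMinorIdeal K n 2).IsPrime ∧
      IsDomain (MvPolynomial (Fin n × Fin n) K ⧸ prinMinorIdeal K n 2) := by
  have h : (prinMinorIdeal K n 2).IsPrime := by
    rw [prinMinorIdeal_two_eq_ker]
    exact RingHom.ker_isPrime _
  exact ⟨h, (Ideal.Quotient.isDomain_iff_prime _).2 h⟩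
end

section
/- For every positive integer n, the binomials x_{ii}x_{jj} − x_{ij}x_{ji} for 1 ≤ i < j ≤ n (the principal 2-minors of X), listed in some order, form a regular sequence in S = K[X]; consequently the ideal P_2 they generate is a complete intersection whose height equals n(n−1)/2. -/
open Matrix

/-- The height of an ideal: the infimum of the heights of the prime ideals
containing it (heights taken in the prime spectrum ordered by inclusion). -/
noncomputable def idealHeight {R : Type*} [CommRing R] (I : Ideal R) : ℕ∞ :=
  ⨅ (p : PrimeSpectrum R) (_ : I ≤ p.asIdeal), Order.height p

open RingTheory.Sequence

/-- The principal 2-minor of the generic matrix on the rows and columns `p.1`, `p.2`. -/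
noncomputable def prinTwoMinor (K : Type*) [CommRing K] {n : ℕ} (p : Fin n × Fin n) :
    MvPolynomial (Fin n × Fin n) K :=
  MvPolynomial.X (p.1, p.1) * MvPolynomial.X (p.2, p.2) -
    MvPolynomial.X (p.1, p.2) * MvPolynomial.X (p.2, p.1)

open Polynomial in
theorem Polynomial.C_sub_C_X_mul_X_mem_nonZeroDivisors {R : Type*} [CommRing R] (c : R) :
    (C (C c) - C X * X : R[X][X]) ∈ nonZeroDivisors R[X][X] := by
  nontriviality R
  apply mem_nonZeroDivisors_of_leadingCoeff
  have h : (C (C c) - C X * X : R[X][X]) = C (-X) * X + C (C c) := by simp; ring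
  rw [h, leadingCoeff_linear (by simp), ← neg_one_mul]
  exact mul_mem isUnit_one.neg.mem_nonZeroDivisors isRegular_X.mem_nonZeroDivisors

/-- If neither the polynomials in `s` nor `c` involve the two distinct variables `u` and `v`,
then `c - X u * X v` is a nonzerodivisor modulo the ideal generated by `s`. -/
theorem MvPolynomial.mem_of_sub_X_mul_X_mul_mem {σ R : Type*} [CommRing R]
    {s : Set (MvPolynomial σ R)} {c : MvPolynomial σ R} {u v : σ} (huv : u ≠ v)
    (hs : ∀ f ∈ s, u ∉ f.vars ∧ v ∉ f.vars) (hc : u ∉ c.vars ∧ v ∉ c.vars)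
    {g : MvPolynomial σ R} (hg : (c - X u * X v) * g ∈ Ideal.span s) : g ∈ Ideal.span s := by
  classical
  obtain ⟨A, _, _, π, hπ⟩ : ∃ (A : Type _) (_ : CommRing A) (_ : Algebra R A)
      (π : MvPolynomial σ R →ₐ[R] A), ∀ f, π f = 0 ↔ f ∈ Ideal.span s :=
    ⟨_, inferInstance, inferInstance, Ideal.Quotient.mkₐ R (Ideal.span s),
      fun _ ↦ Ideal.Quotient.eq_zero_iff_mem⟩
  let φ : MvPolynomial σ R →ₐ[R] Polynomial (Polynomial A) := aeval fun i ↦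
    if i = u then Polynomial.C Polynomial.X else if i = v then Polynomial.X
    else Polynomial.C (Polynomial.C (π (X i)))
  have hφ : ∀ f : MvPolynomial σ R, u ∉ f.vars ∧ v ∉ f.vars →
      φ f = Polynomial.C (Polynomial.C (π f)) := by
    intro f hf
    refine hom_congr_vars (f₁ := φ.toRingHom)
      (f₂ := (Polynomial.C.comp Polynomial.C).comp π.toRingHom) (p₁ := f) (p₂ := f) ?_ ?_ rfl
    · ext1 r
      change φ (C r) = Polynomial.C (Polynomial.C (π (C r)))
      rw [← algebraMap_eq, AlgHom.commutes, AlgHom.commutes]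
      rfl
    · intro i hi _
      change φ (X i) = Polynomial.C (Polynomial.C (π (X i)))
      have hu : i ≠ u := by rintro rfl; exact hf.1 hi
      have hv : i ≠ v := by rintro rfl; exact hf.2 hi
      simp [φ, hu, hv]
  have hI : ∀ f ∈ Ideal.span s, φ f = 0 := by
    intro f hf
    have : Ideal.span s ≤ RingHom.ker φ := by
      rw [Ideal.span_le]
      intro f hf
      have h0 : π f = 0 := (hπ f).mpr (Ideal.subset_span hf)
      simp [hφ f (hs f hf), h0]
    exact this hf
  let ψ : Polynomial (Polynomial A) →+* A :=
    (Polynomial.evalRingHom (π (X u))).comp (Polynomial.evalRingHom (Polynomial.C (π (X v))))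
  have hψ : ψ.comp φ.toRingHom = π.toRingHom := by
    ext i
    · simp [ψ, φ, Polynomial.algebraMap_apply]
    · by_cases hu : i = u
      · subst hu; simp [ψ, φ]
      · by_cases hv : i = v
        · subst hv; simp [ψ, φ, hu]
        · simp [ψ, φ, hu, hv]
  have h0 : φ g = 0 := by
    have h := hI _ hg
    rw [map_mul, map_sub, map_mul, hφ c hc] at h
    have hX : φ (X u) = Polynomial.C Polynomial.X ∧ φ (X v) = Polynomial.X := by
      simp [φ, huv.symm]
    rw [hX.1, hX.2] at h
    exact (mul_left_mem_nonZeroDivisors_eq_zero_iff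
      (Polynomial.C_sub_C_X_mul_X_mem_nonZeroDivisors _)).mp h
  have h1 : π g = ψ (φ g) := (RingHom.congr_fun hψ g).symm
  rw [h0, map_zero] at h1
  exact (hπ g).mp h1

theorem RingTheory.Sequence.IsWeaklyRegular.length_le_height {R : Type*} [CommRing R]
    {l : List R} (hl : IsWeaklyRegular R l) (p : Ideal R) [p.IsPrime]
    (hp : Ideal.ofList l ≤ p) : (l.length : ℕ∞) ≤ p.height := by
  induction l using List.reverseRecOn generalizing p with
  | nil => simp
  | append_singleton l a ih =>
    rw [isWeaklyRegular_append_iff, isWeaklyRegular_singleton_iff] at hl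
    rw [Ideal.ofList_append, sup_le_iff, Ideal.ofList_singleton,
      Ideal.span_singleton_le_iff_mem] at hp
    obtain ⟨q, hq, hqp⟩ := Ideal.exists_minimalPrimes_le hp.1
    have := hq.isPrime
    have ha : a ∉ q := by
      apply hl.2.notMem_of_mem_minimalPrimes
      rwa [smul_eq_mul, Ideal.mul_top, Ideal.annihilator_quotient]
    have hlt : q < p := lt_of_le_of_ne hqp fun h ↦ ha (h ▸ hp.2)
    calc ((l ++ [a]).length : ℕ∞) = l.length + 1 := by simp
      _ ≤ q.height + 1 := by gcongr; exact ih hl.1 q hq.1.2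
      _ ≤ p.height := Ideal.height_add_one_le_of_lt_of_isPrime hlt

theorem notMem_vars_prinTwoMinor {K : Type*} [CommRing K] [Nontrivial K] {n : ℕ}
    {p : Fin n × Fin n} {u v : Fin n} (huv : u ≠ v) (h₁ : (u, v) ≠ p) (h₂ : (v, u) ≠ p) :
    (u, v) ∉ (prinTwoMinor K p).vars := by
  classical
  intro h
  obtain ⟨i, j⟩ := p
  rcases Finset.mem_union.mp (MvPolynomial.vars_sub_subset _ h) with h | h <;>
    rcases Finset.mem_union.mp (MvPolynomial.vars_mul _ _ h) with h | h <;>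
    simp [MvPolynomial.vars_X] at h <;> simp_all

theorem isWeaklyRegular_map_prinTwoMinor {K : Type*} [CommRing K] [Nontrivial K] {n : ℕ}
    {l : List (Fin n × Fin n)} (hl : l.Nodup) (hlt : ∀ p ∈ l, p.1 < p.2) :
    IsWeaklyRegular (MvPolynomial (Fin n × Fin n) K) (l.map (prinTwoMinor K)) := by
  classical
  induction l using List.reverseRecOn with
  | nil => simp
  | append_singleton l a ih =>
    obtain ⟨u, v⟩ := a
    have huv : u < v := hlt (u, v) (by simp)
    rw [List.map_append, isWeaklyRegular_append_iff]
    refine ⟨ih hl.of_append_left fun p hp ↦ hlt p (by simp [hp]), ?_⟩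
    rw [List.map_singleton, isWeaklyRegular_singleton_iff, isSMulRegular_iff_right_eq_zero_of_smul]
    intro g hg
    obtain ⟨g, rfl⟩ := Submodule.Quotient.mk_surjective _ g
    rw [← Submodule.Quotient.mk_smul, Submodule.Quotient.mk_eq_zero] at hg
    rw [Submodule.Quotient.mk_eq_zero]
    simp only [smul_eq_mul, Ideal.mul_top] at hg ⊢
    refine MvPolynomial.mem_of_sub_X_mul_X_mul_mem (u := (u, v)) (v := (v, u))
      (by simp [huv.ne]) ?_ ?_ hg
    · intro f hf
      obtain ⟨p, hp, rfl⟩ := List.mem_map.mp hf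
      have h₁ : (u, v) ≠ p := by
        rintro rfl
        simp [List.nodup_append] at hl
        exact hl.2 _ _ hp rfl rfl
      have h₂ : (v, u) ≠ p := by
        rintro rfl
        exact huv.asymm (hlt (v, u) (by simp [hp]))
      exact ⟨notMem_vars_prinTwoMinor huv.ne h₁ h₂, notMem_vars_prinTwoMinor huv.ne' h₂ h₁⟩
    · constructor <;> intro h <;>
        rcases Finset.mem_union.mp (MvPolynomial.vars_mul _ _ h) with h | h <;>
        simp [MvPolynomial.vars_X] at h <;> simp_all

theorem prinTwoMinor_injOn (K : Type*) [CommRing K] [Nontrivial K] (n : ℕ) :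
    Set.InjOn (prinTwoMinor K (n := n)) {p | p.1 < p.2} := by
  classical
  rintro ⟨i, j⟩ hij ⟨k, l⟩ hkl h
  have h := congrArg (MvPolynomial.eval fun q ↦ if q = (i, j) ∨ q = (j, i) then (1 : K) else 0) h
  simp only [Set.mem_ofPred_eq] at hij hkl
  have hkl' : ¬ (k = i ∧ k = j) := fun h ↦ hij.ne (h.1.symm.trans h.2)
  have hkl'' : ¬ (k = j ∧ k = i) := fun h ↦ hij.ne (h.2.symm.trans h.1)
  by_contra hne
  have h1 : ¬ (k = i ∧ l = j) := fun h ↦ hne (by simp [h])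
  have h2 : ¬ (k = j ∧ l = i) := fun h ↦ by omega
  simp [prinTwoMinor, hij.ne, hkl', hkl'', h1, h2] at h

theorem det_submatrix_pair {R : Type*} [CommRing R] {n : ℕ} (M : Matrix (Fin n) (Fin n) R)
    {i j : Fin n} (hij : i < j) {s : Finset (Fin n)} (hs : s = {i, j}) :
    (M.submatrix (fun a : {x // x ∈ s} ↦ (a : Fin n)) (fun a : {x // x ∈ s} ↦ (a : Fin n))).det =
      M i i * M j j - M i j * M j i := by
  subst hs
  have hc : ({i, j} : Finset (Fin n)).card = 2 := Finset.card_pair hij.ne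
  let f : Fin 2 → {x // x ∈ ({i, j} : Finset (Fin n))} := ![⟨i, by simp⟩, ⟨j, by simp⟩]
  have hf : Function.Bijective f := by
    rw [Fintype.bijective_iff_injective_and_card]
    refine ⟨?_, by rw [Fintype.card_coe, hc, Fintype.card_fin]⟩
    intro a b h
    fin_cases a <;> fin_cases b <;> simp [f, hij.ne, hij.ne'] at h ⊢
  rw [← Matrix.det_submatrix_equiv_self (Equiv.ofBijective f hf), Matrix.det_fin_two]
  simp [f]

theorem card_filter_fst_lt_snd (n : ℕ) :
    (Finset.univ.filter fun p : Fin n × Fin n ↦ p.1 < p.2).card = n * (n - 1) / 2 := by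
  rw [← Finset.sum_range_id, ← Fin.sum_univ_eq_sum_range (fun i ↦ i),
    Finset.card_filter, Fintype.sum_prod_type_right]
  refine Finset.sum_congr rfl fun j _ ↦ ?_
  rw [← Finset.card_filter, ← Fin.card_Iio j]
  congr 1
  ext i
  simp

/-- The principal 2-minors `x i i * x j j - x i j * x j i` (for `i < j`), listed in
some order, form a regular sequence in `S = K[X]`; consequently the ideal `P₂` they
generate is a complete intersection whose height equals `n(n-1)/2`. -/
theorem prinMinors_two_regular_sequence (K : Type*) [Field K] [IsAlgClosed K]
    (n : ℕ) (hn : 0 < n) :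
    ∃ l : List (MvPolynomial (Fin n × Fin n) K),
      l.Nodup ∧
      (∀ p, p ∈ l ↔ ∃ i j : Fin n, i < j ∧
        p = MvPolynomial.X (i, i) * MvPolynomial.X (j, j) -
            MvPolynomial.X (i, j) * MvPolynomial.X (j, i)) ∧
      RingTheory.Sequence.IsRegular (MvPolynomial (Fin n × Fin n) K) l ∧
      Ideal.ofList l = prinMinorIdeal K n 2 ∧
      idealHeight (prinMinorIdeal K n 2) = ((n * (n - 1) / 2 : ℕ) : ℕ∞) := by
  classical
  set F : Finset (Fin n × Fin n) := Finset.univ.filter fun p ↦ p.1 < p.2 with hF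
  have hlt : ∀ p ∈ F.toList, p.1 < p.2 := by simp [hF]
  set l := F.toList.map (prinTwoMinor K) with hl
  have hmem : ∀ p, p ∈ l ↔ ∃ i j : Fin n, i < j ∧
      p = MvPolynomial.X (i, i) * MvPolynomial.X (j, j) -
          MvPolynomial.X (i, j) * MvPolynomial.X (j, i) := by
    intro p
    simp [hl, hF, prinTwoMinor, eq_comm]
  have hlen : l.length = n * (n - 1) / 2 := by
    rw [hl, List.length_map, Finset.length_toList, card_filter_fst_lt_snd]
  have hnodup : l.Nodup := F.nodup_toList.map_on fun p hp q hq h ↦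
    prinTwoMinor_injOn K n (hlt p hp) (hlt q hq) h
  have hweak : IsWeaklyRegular (MvPolynomial (Fin n × Fin n) K) l :=
    isWeaklyRegular_map_prinTwoMinor F.nodup_toList hlt
  have hideal : Ideal.ofList l = prinMinorIdeal K n 2 := by
    unfold Ideal.ofList prinMinorIdeal
    congr 1
    ext p
    rw [Set.mem_ofPred_eq, Set.mem_ofPred_eq, hmem]
    constructor
    · rintro ⟨i, j, hij, rfl⟩
      exact ⟨{i, j}, Finset.card_pair hij.ne, (det_submatrix_pair (genMat K n) hij rfl).symm⟩
    · rintro ⟨s, hs, rfl⟩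
      obtain ⟨i, j, hij, hs⟩ := Finset.card_eq_two.mp hs
      rcases hij.lt_or_gt with hij | hij
      · exact ⟨i, j, hij, det_submatrix_pair (genMat K n) hij hs⟩
      · exact ⟨j, i, hij, det_submatrix_pair (genMat K n) hij (hs.trans (Finset.pair_comm i j))⟩
  have hne : Ideal.ofList l ≠ ⊤ := by
    intro h
    have hle : Ideal.ofList l ≤
        RingHom.ker (MvPolynomial.eval fun _ : Fin n × Fin n ↦ (0 : K)) := by
      refine Ideal.span_le.mpr fun p hp ↦ ?_
      obtain ⟨i, j, -, rfl⟩ := (hmem p).mp hp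
      simp
    exact RingHom.ker_ne_top _ (top_le_iff.mp (h ▸ hle))
  refine ⟨l, hnodup, hmem, ⟨hweak, ?_⟩, hideal, ?_⟩
  · rw [smul_eq_mul, Ideal.mul_top]
    exact hne.symm
  · rw [← hideal, ← hlen]
    apply le_antisymm
    · obtain ⟨q, hq⟩ := Ideal.nonempty_minimalPrimes hne
      have := hq.isPrime
      refine (iInf₂_le (⟨q, this⟩ : PrimeSpectrum _) hq.1.2).trans ?_
      rw [← PrimeSpectrum.height_eq_orderHeight, ← List.toFinset_card_of_nodup hnodup]
      apply Ideal.height_le_card_of_mem_minimalPrimes_span_finset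
      rwa [List.coe_toFinset]
    · refine le_iInf₂ fun p hp ↦ ?_
      rw [← PrimeSpectrum.height_eq_orderHeight]
      exact hweak.length_le_height p.asIdeal hp
end

section
/- (Jacobi–Muir) Let R be a commutative ring and A an n×n matrix over R. Let I = {i_1,…,i_t} and J = {j_1,…,j_t} be subsets of {1,…,n} of cardinality t, and let μ be the t×t minor of the adjugate Adj(A) with rows indexed by I and columns indexed by J. Then μ = (det A)^{t−1} · (−1)^{σ} · det A(J^c; I^c), where σ = i_1+⋯+i_t+j_1+⋯+j_t and A(J^c; I^c) is the submatrix of A with rows indexed by the complement of J and columns indexed by the complement of I. -/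
open Matrix

/-- If `N` is a right inverse of `M` up to the scalar `d`, then complementary blocks of `M` and `N`
have proportional determinants. -/
theorem Matrix.det_mul_det_toBlocks₁₁_of_mul_eq_smul_one {R m k : Type*} [CommRing R]
    [Fintype m] [DecidableEq m] [Fintype k] [DecidableEq k] {M N : Matrix (m ⊕ k) (m ⊕ k) R}
    {d : R} (h : M * N = d • 1) :
    M.det * N.toBlocks₁₁.det = d ^ Fintype.card m * M.toBlocks₂₂.det := by
  have key : M * fromBlocks N.toBlocks₁₁ 0 N.toBlocks₂₁ 1 =
      fromBlocks (d • 1) M.toBlocks₁₂ 0 M.toBlocks₂₂ := by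
    rw [← fromBlocks_toBlocks M, ← fromBlocks_toBlocks N, fromBlocks_multiply,
      ← fromBlocks_one, fromBlocks_smul, fromBlocks_inj] at h
    conv_lhs => rw [← fromBlocks_toBlocks M]
    rw [fromBlocks_multiply, h.1, h.2.2.1]
    simp
  simpa [det_smul] using congrArg det key

/-- A map that is strictly monotone on a finset carries its increasing enumeration to the
increasing enumeration of the image. -/
theorem Finset.orderEmbOfFin_apply_of_strictMonoOn {α β : Type*} [LinearOrder α] [LinearOrder β]
    {s : Finset α} {s' : Finset β} {k : ℕ} (hs : s.card = k) (hs' : s'.card = k) {f : α → β}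
    (hf : StrictMonoOn f s) (hmem : ∀ x ∈ s, f x ∈ s') (a : Fin k) :
    s'.orderEmbOfFin hs' a = f (s.orderEmbOfFin hs a) :=
  (congrFun (Finset.orderEmbOfFin_unique hs' (f := fun a => f (s.orderEmbOfFin hs a))
    (fun _ => hmem _ (s.orderEmbOfFin_mem hs _))
    (fun _ _ hab => hf (s.orderEmbOfFin_mem hs _) (s.orderEmbOfFin_mem hs _)
      ((s.orderEmbOfFin hs).strictMono hab))) a).symm

/-- An adjacent transposition is strictly monotone on every set missing one of the two points. -/
theorem Fin.strictMonoOn_swap_of_notMem {n : ℕ} {a b : Fin n} (hab : (a : ℕ) + 1 = b)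
    {s : Set (Fin n)} (hs : a ∉ s ∨ b ∉ s) : StrictMonoOn (Equiv.swap a b) s := by
  intro x hx y hy hxy
  have hx' : (x = a → a ∈ s) ∧ (x = b → b ∈ s) := by constructor <;> rintro rfl <;> exact hx
  have hy' : (y = a → a ∈ s) ∧ (y = b → b ∈ s) := by constructor <;> rintro rfl <;> exact hy
  simp only [Equiv.swap_apply_def]
  split_ifs <;> simp only [Fin.lt_def, Fin.ext_iff] at * <;> first | omega | (exfalso; tauto)

/-- A finset of `Fin n` that is not a lower set contains the successor of a non-member. -/
theorem Fin.exists_notMem_succ_mem_of_not_isLowerSet {n : ℕ} {s : Finset (Fin n)}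
    (hs : ¬ IsLowerSet (s : Set (Fin n))) :
    ∃ a b : Fin n, (a : ℕ) + 1 = b ∧ a ∉ s ∧ b ∈ s := by
  by_contra! h
  refine hs fun b a hab hb => ?_
  obtain ⟨d, hd⟩ := Nat.exists_eq_add_of_le (Fin.le_def.1 hab)
  induction d generalizing a with
  | zero => exact (Fin.ext hd : b = a) ▸ hb
  | succ d ih =>
    have hlt : (a : ℕ) + 1 < n := by omega
    by_contra ha
    exact h a ⟨a + 1, hlt⟩ rfl ha (ih (a := ⟨a + 1, hlt⟩) (Fin.le_def.2 (by simp; omega))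
      (by simp; omega))

/-- Swapping a member of a finset with its non-member predecessor lowers the sum by one and
composes the enumeration with the transposition. -/
theorem Fin.exists_finSumEquivOfFinset_eq_trans_swap {n t k : ℕ} {I : Finset (Fin n)}
    (hI : I.card = t) (hIc : Iᶜ.card = k) (hlow : ¬ IsLowerSet (I : Set (Fin n))) :
    ∃ (I' : Finset (Fin n)) (hI' : I'.card = t) (hIc' : I'ᶜ.card = k) (a b : Fin n),
      a ≠ b ∧ ∑ i ∈ I', (i : ℕ) + 1 = ∑ i ∈ I, (i : ℕ) ∧
      finSumEquivOfFinset hI hIc = (finSumEquivOfFinset hI' hIc').trans (Equiv.swap a b) := by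
  obtain ⟨a, b, hab, ha, hb⟩ := Fin.exists_notMem_succ_mem_of_not_isLowerSet hlow
  have hne : a ≠ b := by rintro rfl; omega
  set I' := I.map (Equiv.swap a b).toEmbedding with hI'_def
  have hmem : ∀ x, x ∈ I ↔ Equiv.swap a b x ∈ I' := fun x => by simp [hI'_def]
  have hcard : I'.card = I.card := Finset.card_map _
  have hI' : I'.card = t := hcard.trans hI
  have hIc' : I'ᶜ.card = k := by rw [← hIc, Finset.card_compl, Finset.card_compl, hcard]
  refine ⟨I', hI', hIc', a, b, hne, ?_, ?_⟩
  · have hval : ∀ i ∈ I, (i : ℕ) = (Equiv.swap a b i : Fin n) + if i = b then 1 else 0 := by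
      intro i hi
      have hia : i ≠ a := by rintro rfl; exact ha hi
      by_cases hib : i = b
      · simp [hib, hab]
      · simp [hib, Equiv.swap_apply_of_ne_of_ne hia hib]
    rw [Finset.sum_congr rfl hval, Finset.sum_add_distrib, hI'_def, Finset.sum_map]
    simp [hb]
  · have hswap : ∀ x y, Equiv.swap a b x = y → x = Equiv.swap a b y := by
      rintro x _ rfl; simp
    ext1 (i | i)
    · refine hswap _ _ ?_
      simpa using (Finset.orderEmbOfFin_apply_of_strictMonoOn hI hI'
        (Fin.strictMonoOn_swap_of_notMem hab (Or.inl (by simpa using ha)))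
        (fun x hx => (hmem x).1 hx) i).symm
    · refine hswap _ _ ?_
      simpa using (Finset.orderEmbOfFin_apply_of_strictMonoOn hIc hIc'
        (Fin.strictMonoOn_swap_of_notMem hab (Or.inr (by simpa using hb)))
        (fun x hx => by simpa [← hmem x] using hx) i).symm

/-- The sign of the permutation taking the increasing enumeration of `I` followed by that of `Iᶜ`
to the one for `J`. -/
theorem Fin.sign_finSumEquivOfFinset_symm_trans {n t k : ℕ} (I J : Finset (Fin n))
    (hI : I.card = t) (hIc : Iᶜ.card = k) (hJ : J.card = t) (hJc : Jᶜ.card = k) :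
    Equiv.Perm.sign ((finSumEquivOfFinset hI hIc).symm.trans (finSumEquivOfFinset hJ hJc)) =
      (-1) ^ (∑ i ∈ I, (i : ℕ) + ∑ j ∈ J, (j : ℕ)) := by
  induction hN : ∑ i ∈ I, (i : ℕ) + ∑ j ∈ J, (j : ℕ) using Nat.strong_induction_on
    generalizing I J with
  | _ N ih =>
  subst hN
  by_cases hIl : IsLowerSet (I : Set (Fin n))
  · by_cases hJl : IsLowerSet (J : Set (Fin n))
    · have hIJ : I = J := by
        rcases hIl.total hJl with h | h
        · exact Finset.eq_of_subset_of_card_le (by simpa using h) (by omega)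
        · exact (Finset.eq_of_subset_of_card_le (by simpa using h) (by omega)).symm
      subst hIJ
      simp [← two_mul, pow_mul]
    · obtain ⟨J', hJ', hJc', a, b, hab, hsum, he⟩ :=
        Fin.exists_finSumEquivOfFinset_eq_trans_swap hJ hJc hJl
      rw [he, ← Equiv.trans_assoc, Equiv.Perm.sign_trans,
        ih _ (by omega) I J' hI hIc hJ' hJc' rfl, Equiv.Perm.sign_swap hab, ← hsum,
        ← add_assoc, pow_succ, mul_comm]
  · obtain ⟨I', hI', hIc', a, b, hab, hsum, he⟩ :=
      Fin.exists_finSumEquivOfFinset_eq_trans_swap hI hIc hIl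
    rw [he, Equiv.symm_trans, Equiv.trans_assoc, Equiv.Perm.sign_trans,
      ih _ (by omega) I' J hI' hIc' hJ hJc rfl, Equiv.symm_swap, Equiv.Perm.sign_swap hab, ← hsum,
      add_right_comm, pow_succ]

/-- Jacobi's identity for minors of the adjugate, multiplied by the determinant. -/
theorem Matrix.det_mul_det_adjugate_submatrix {R : Type*} [CommRing R] {n t k : ℕ}
    (A : Matrix (Fin n) (Fin n) R) (I J : Finset (Fin n))
    (hI : I.card = t) (hIc : Iᶜ.card = k) (hJ : J.card = t) (hJc : Jᶜ.card = k) :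
    A.det * (A.adjugate.submatrix (I.orderEmbOfFin hI) (J.orderEmbOfFin hJ)).det =
      A.det ^ t * (-1) ^ (∑ i ∈ I, (i : ℕ) + ∑ j ∈ J, (j : ℕ)) *
        (A.submatrix (Jᶜ.orderEmbOfFin hJc) (Iᶜ.orderEmbOfFin hIc)).det := by
  set e := finSumEquivOfFinset hI hIc with he
  set f := finSumEquivOfFinset hJ hJc with hf
  set σ := ∑ i ∈ I, (i : ℕ) + ∑ j ∈ J, (j : ℕ) with hσ
  have hmul : A.submatrix f e * A.adjugate.submatrix e f = A.det • 1 := by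
    rw [submatrix_mul_equiv, mul_adjugate]
    ext i j
    simp [Matrix.one_apply]
  have hdet : (A.submatrix f e).det = (-1) ^ σ * A.det := by
    have h : A.submatrix f e = (A.submatrix (e.symm.trans f) id).submatrix e e := by
      ext; simp
    rw [h, det_submatrix_equiv_self, det_permute, he, hf,
      Fin.sign_finSumEquivOfFinset_symm_trans, ← hσ]
    simp
  have hblock := det_mul_det_toBlocks₁₁_of_mul_eq_smul_one hmul
  have h₁₁ : (A.adjugate.submatrix e f).toBlocks₁₁ =
      A.adjugate.submatrix (I.orderEmbOfFin hI) (J.orderEmbOfFin hJ) := by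
    ext; simp [toBlocks₁₁, he, hf]
  have h₂₂ : (A.submatrix f e).toBlocks₂₂ =
      A.submatrix (Jᶜ.orderEmbOfFin hJc) (Iᶜ.orderEmbOfFin hIc) := by
    ext; simp [toBlocks₂₂, he, hf]
  rw [hdet, h₁₁, h₂₂, Fintype.card_fin] at hblock
  have hsq : ((-1 : R) ^ σ) * (-1) ^ σ = 1 := by rw [← mul_pow]; simp
  linear_combination (-1 : R) ^ σ * hblock -
    A.det * (A.adjugate.submatrix (I.orderEmbOfFin hI) (J.orderEmbOfFin hJ)).det * hsq

/-- Jacobi's identity for minors of the adjugate. -/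
theorem Matrix.det_adjugate_submatrix {R : Type*} [CommRing R] {n t k : ℕ} (ht : 1 ≤ t)
    (A : Matrix (Fin n) (Fin n) R) (I J : Finset (Fin n))
    (hI : I.card = t) (hIc : Iᶜ.card = k) (hJ : J.card = t) (hJc : Jᶜ.card = k) :
    (A.adjugate.submatrix (I.orderEmbOfFin hI) (J.orderEmbOfFin hJ)).det =
      A.det ^ (t - 1) * (-1) ^ (∑ i ∈ I, (i : ℕ) + ∑ j ∈ J, (j : ℕ)) *
        (A.submatrix (Jᶜ.orderEmbOfFin hJc) (Iᶜ.orderEmbOfFin hIc)).det := by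
  let X := mvPolynomialX (Fin n) (Fin n) ℤ
  let φ := (MvPolynomial.aeval fun p : Fin n × Fin n => A p.1 p.2 :
    MvPolynomial (Fin n × Fin n) ℤ →ₐ[ℤ] R)
  have hX : (X.adjugate.submatrix (I.orderEmbOfFin hI) (J.orderEmbOfFin hJ)).det =
      X.det ^ (t - 1) * (-1) ^ (∑ i ∈ I, (i : ℕ) + ∑ j ∈ J, (j : ℕ)) *
        (X.submatrix (Jᶜ.orderEmbOfFin hJc) (Iᶜ.orderEmbOfFin hIc)).det := by
    apply mul_left_cancel₀ (show X.det ≠ 0 from det_mvPolynomialX_ne_zero (Fin n) ℤ)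
    rw [det_mul_det_adjugate_submatrix, ← mul_assoc, ← mul_assoc, mul_pow_sub_one (by omega)]
  have hφ : φ.mapMatrix X = A := mvPolynomialX_mapMatrix_aeval ℤ A
  have h := congrArg φ hX
  simp only [map_mul, map_pow, map_neg, map_one, AlgHom.map_det, AlgHom.mapMatrix_apply,
    ← submatrix_map] at h
  simpa only [← AlgHom.mapMatrix_apply, AlgHom.map_adjugate, hφ] using h

/-- **Jacobi–Muir theorem.**  Let `A` be an `n × n` matrix over a commutative ring
`R`, and let `I`, `J` be subsets of the index set of cardinality `t ≥ 1`.  The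
`t × t` minor of the adjugate `Adj(A)` with rows `I` and columns `J` equals
`(det A)^(t-1) · (-1)^σ · det A(Jᶜ; Iᶜ)`, where `σ` is the sum of the (1-based)
indices in `I` and `J` and `A(Jᶜ; Iᶜ)` is the submatrix of `A` with rows the
complement of `J` and columns the complement of `I`. -/
theorem adjugate_minor_eq (R : Type*) [CommRing R] (n t : ℕ) (ht : 1 ≤ t)
    (A : Matrix (Fin n) (Fin n) R) (I J : Finset (Fin n))
    (hI : I.card = t) (hJ : J.card = t)
    (hIc : Iᶜ.card = n - t) (hJc : Jᶜ.card = n - t) :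
    (Matrix.of fun a b : Fin t =>
        A.adjugate (I.orderIsoOfFin hI a) (J.orderIsoOfFin hJ b)).det =
      A.det ^ (t - 1) *
        (-1 : R) ^ ((∑ i ∈ I, ((i : ℕ) + 1)) + ∑ j ∈ J, ((j : ℕ) + 1)) *
        (Matrix.of fun a b : Fin (n - t) =>
          A (Jᶜ.orderIsoOfFin hJc a) (Iᶜ.orderIsoOfFin hIc b)).det := by
  have hσ : ∑ i ∈ I, ((i : ℕ) + 1) + ∑ j ∈ J, ((j : ℕ) + 1) =
      ∑ i ∈ I, (i : ℕ) + ∑ j ∈ J, (j : ℕ) + 2 * t := by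
    simp only [Finset.sum_add_distrib, Finset.sum_const, hI, hJ, smul_eq_mul, mul_one]
    ring
  rw [hσ, pow_add _ _ (2 * t), pow_mul _ 2 t, neg_one_sq, one_pow, mul_one]
  exact det_adjugate_submatrix ht A I J hI hIc hJ hJc
end

section
/- Let A be an invertible n×n matrix over a field K and let s ⊆ {1,…,n} with |s| = t. Then the principal t-minor of A^{−1} indexed by s equals (det A)^{−1} times the principal (n−t)-minor of A indexed by the complement of s: det((A^{−1})(s; s)) = (det A)^{−1} · det(A(s^c; s^c)). -/
open Matrix

theorem Matrix.det_mul_det_toBlocks₁₁_of_mul_eq_one {R m p : Type*} [CommRing R]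
    [Fintype m] [DecidableEq m] [Fintype p] [DecidableEq p]
    {M N : Matrix (m ⊕ p) (m ⊕ p) R} (h : M * N = 1) :
    M.det * N.toBlocks₁₁.det = M.toBlocks₂₂.det := by
  rw [← fromBlocks_toBlocks M, ← fromBlocks_toBlocks N, fromBlocks_multiply,
    ← fromBlocks_one, fromBlocks_inj] at h
  have key : M * fromBlocks N.toBlocks₁₁ 0 N.toBlocks₂₁ 1 =
      fromBlocks 1 M.toBlocks₁₂ 0 M.toBlocks₂₂ := by
    conv_lhs => rw [← fromBlocks_toBlocks M]
    rw [fromBlocks_multiply, h.1, h.2.2.1]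
    simp
  simpa [det_mul] using congrArg det key

/-- Let `A` be an invertible `n × n` matrix over a field `K` and `s` a subset of the
index set with `|s| = t`.  Then the principal `t`-minor of `A⁻¹` indexed by `s`
equals `(det A)⁻¹` times the principal `(n-t)`-minor of `A` indexed by the
complement of `s`. -/
theorem inv_principal_minor (K : Type*) [Field K] (n t : ℕ)
    (A : Matrix (Fin n) (Fin n) K) (hA : IsUnit A.det)
    (s : Finset (Fin n)) (hs : s.card = t) :
    ((A⁻¹).submatrix (fun i : {x // x ∈ s} => (i : Fin n))
        (fun j : {x // x ∈ s} => (j : Fin n))).det =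
      (A.det)⁻¹ *
        (A.submatrix (fun i : {x // x ∈ sᶜ} => (i : Fin n))
          (fun j : {x // x ∈ sᶜ} => (j : Fin n))).det := by
  let e : {x // x ∈ s} ⊕ {x // x ∈ sᶜ} ≃ Fin n :=
    ((Equiv.refl _).sumCongr (Equiv.subtypeEquivRight fun _ => Finset.mem_compl)).trans
      (Equiv.sumCompl (· ∈ s))
  have h : A.submatrix e e * A⁻¹.submatrix e e = 1 := by
    rw [submatrix_mul_equiv, mul_nonsing_inv A hA, submatrix_one_equiv]
  have hdet := det_mul_det_toBlocks₁₁_of_mul_eq_one h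
  rw [det_submatrix_equiv_self] at hdet
  exact (eq_inv_mul_iff_mul_eq₀ hA.ne_zero).2 hdet
end

section
/- Let A be an invertible n×n matrix over a field K and let 1 ≤ t ≤ n. Then all principal t-minors of A vanish if and only if all principal (n−t)-minors of A^{−1} vanish. (This is the set-theoretic content of the isomorphism Y_{n,n,t} ≅ Y_{n,n,n−t} induced by X ↦ X^{−1}.) -/
open Matrix

/-- Jacobi's complementary minor formula for principal minors. -/
theorem Matrix.det_mul_det_toBlock_not_of_mul_eq_one {m R : Type*} [Fintype m] [DecidableEq m]
    [CommRing R] {M N : Matrix m m R} (h : M * N = 1) (p : m → Prop) [DecidablePred p] :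
    M.det * (N.toBlock (fun i => ¬p i) fun i => ¬p i).det = (M.toBlock p p).det := by
  have hcol (q : m → Prop) : M.toBlock q p * N.toBlock p (fun i => ¬p i) +
      M.toBlock q (fun i => ¬p i) * N.toBlock (fun i => ¬p i) (fun i => ¬p i) =
        (1 : Matrix m m R).toBlock q fun i => ¬p i := by
    rw [← h, toBlock_mul_eq_add q p]
  have hmul : fromBlocks (M.toBlock p p) (M.toBlock p fun i => ¬p i)
      (M.toBlock (fun i => ¬p i) p) (M.toBlock (fun i => ¬p i) fun i => ¬p i) *
      fromBlocks 1 (N.toBlock p fun i => ¬p i) 0 (N.toBlock (fun i => ¬p i) fun i => ¬p i) =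
      fromBlocks (M.toBlock p p) 0 (M.toBlock (fun i => ¬p i) p) 1 := by
    have h0 : (1 : Matrix m m R).toBlock p (fun i => ¬p i) = 0 :=
      toBlock_one_disjoint (disjoint_compl_right (a := p))
    rw [fromBlocks_multiply, hcol, hcol, toBlock_one_self, h0]
    simp
  rw [det_toBlock M p]
  simpa [det_fromBlocks_zero₂₁, det_fromBlocks_zero₁₂] using congrArg det hmul

theorem Matrix.det_submatrix_eq_zero_iff_inv_compl {m K : Type*} [Fintype m] [DecidableEq m]
    [Field K] {A : Matrix m m K} (hA : IsUnit A.det) (s : Finset m) :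
    (A.submatrix (fun i : {x // x ∈ s} => (i : m)) fun j : {x // x ∈ s} => (j : m)).det = 0 ↔
      (A⁻¹.submatrix (fun i : {x // x ∈ sᶜ} => (i : m))
        fun j : {x // x ∈ sᶜ} => (j : m)).det = 0 := by
  have h := det_mul_det_toBlock_not_of_mul_eq_one (A.mul_nonsing_inv hA) (· ∈ s)
  have hdet : A.det * (A⁻¹.submatrix (fun i : {x // x ∈ sᶜ} => (i : m))
      fun j : {x // x ∈ sᶜ} => (j : m)).det =
      (A.submatrix (fun i : {x // x ∈ s} => (i : m)) fun j : {x // x ∈ s} => (j : m)).det := by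
    convert h using 2
    · exact det_submatrix_equiv_self
        (Equiv.subtypeEquivRight fun i => (Finset.mem_compl : i ∈ sᶜ ↔ i ∉ s))
        (A⁻¹.toBlock (fun i => i ∉ s) fun i => i ∉ s)
    · rfl
  rw [← hdet, mul_eq_zero, or_iff_right hA.ne_zero]

/-- Let `A` be an invertible `n × n` matrix over a field `K` and `1 ≤ t ≤ n`.  Then
all principal `t`-minors of `A` vanish if and only if all principal `(n-t)`-minors
of `A⁻¹` vanish.  (This is the set-theoretic content of the isomorphism
`Y_{n,n,t} ≅ Y_{n,n,n-t}` induced by `X ↦ X⁻¹`.) -/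
theorem principal_minors_vanish_iff_inv (K : Type*) [Field K] (n t : ℕ)
    (ht1 : 1 ≤ t) (ht2 : t ≤ n)
    (A : Matrix (Fin n) (Fin n) K) (hA : IsUnit A.det) :
    (∀ s : Finset (Fin n), s.card = t →
        (A.submatrix (fun i : {x // x ∈ s} => (i : Fin n))
          (fun j : {x // x ∈ s} => (j : Fin n))).det = 0) ↔
      (∀ s : Finset (Fin n), s.card = n - t →
        ((A⁻¹).submatrix (fun i : {x // x ∈ s} => (i : Fin n))
          (fun j : {x // x ∈ s} => (j : Fin n))).det = 0) := by
  constructor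
  · intro h s hs
    have hc : sᶜ.card = t := by
      rw [Finset.card_compl, Fintype.card_fin, hs, Nat.sub_sub_self ht2]
    have := (det_submatrix_eq_zero_iff_inv_compl hA sᶜ).1 (h _ hc)
    rwa [compl_compl] at this
  · intro h s hs
    refine (det_submatrix_eq_zero_iff_inv_compl hA s).2 (h _ ?_)
    rw [Finset.card_compl, Fintype.card_fin, hs]
end

section
/- For every n ≥ 2, the extension P_{n−1}·S_Δ of the principal (n−1)-minor ideal to the localization S_Δ = S[1/Δ] is a prime ideal of S_Δ of height n. (Equivalently, the locally closed set Y_{n,n,n−1} of invertible matrices with vanishing principal (n−1)-minors is irreducible of codimension n.) -/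
open Matrix

section PrincipalMinors

variable {R : Type*} [CommRing R] {n : ℕ}

/-- Diagonal entries of the adjugate are the principal minors of corank one. -/
lemma det_submatrix_erase_eq_adjugate (A : Matrix (Fin n) (Fin n) R) (i : Fin n) :
    (A.submatrix (fun j : {x // x ∈ Finset.univ.erase i} => (j : Fin n))
      (fun j : {x // x ∈ Finset.univ.erase i} => (j : Fin n))).det = A.adjugate i i := by
  obtain _ | m := n
  · exact i.elim0
  rw [adjugate_fin_succ_eq_det_submatrix, Even.neg_one_pow ⟨_, rfl⟩, one_mul]
  let e : Fin m ≃ {x // x ∈ Finset.univ.erase i} :=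
    (finSuccAboveEquiv i).trans (Equiv.subtypeEquivRight (by simp))
  rw [← det_submatrix_equiv_self e]
  rfl

lemma map_inv_of_isUnit_det {S : Type*} [CommRing S] (f : R →+* S)
    {A : Matrix (Fin n) (Fin n) R} (hA : IsUnit A.det) : A⁻¹.map f = (A.map f)⁻¹ := by
  refine (inv_eq_right_inv ?_).symm
  rw [← Matrix.map_mul, mul_nonsing_inv A hA]
  exact Matrix.map_one f f.map_zero f.map_one

lemma inv_apply_eq (A : Matrix (Fin n) (Fin n) R) (i j : Fin n) :
    A⁻¹ i j = Ring.inverse A.det * A.adjugate i j := by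
  rw [inv_def]
  rfl

end PrincipalMinors

lemma idealHeight_eq_height {R : Type*} [CommRing R] (I : Ideal R) [hI : I.IsPrime] :
    idealHeight I = Order.height (⟨I, hI⟩ : PrimeSpectrum R) := by
  unfold idealHeight
  refine le_antisymm (iInf₂_le (⟨I, hI⟩ : PrimeSpectrum R) le_rfl) (le_iInf₂ fun p h => ?_)
  exact Order.height_mono (show (⟨I, hI⟩ : PrimeSpectrum R) ≤ p from h)

section Generic

variable (K : Type*) [Field K] (n : ℕ)

lemma prinMinorIdeal_sub_one_eq_span (hn : 1 ≤ n) :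
    prinMinorIdeal K n (n - 1) =
      Ideal.span (Set.range fun i => (genMat K n).adjugate i i) := by
  unfold prinMinorIdeal
  congr 1
  ext p
  constructor
  · rintro ⟨s, hs, rfl⟩
    have hc : sᶜ.card = 1 := by
      rw [Finset.card_compl, hs, Fintype.card_fin]
      lia
    obtain ⟨i, hi⟩ := Finset.card_eq_one.mp hc
    obtain rfl : s = Finset.univ.erase i := by
      rw [← compl_compl s, hi, Finset.compl_singleton]
    exact ⟨i, (det_submatrix_erase_eq_adjugate _ i).symm⟩
  · rintro ⟨i, rfl⟩
    exact ⟨Finset.univ.erase i, by simp, (det_submatrix_erase_eq_adjugate _ i).symm⟩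

/-- The coordinate ring of the general linear group. -/
abbrev GLRing := Localization.Away (genMat K n).det

/-- The generic invertible matrix. -/
noncomputable def genInv : Matrix (Fin n) (Fin n) (GLRing K n) :=
  (genMat K n).map (algebraMap _ (GLRing K n))

lemma det_genInv : (genInv K n).det = algebraMap _ (GLRing K n) (genMat K n).det :=
  ((algebraMap _ (GLRing K n)).map_det (genMat K n)).symm

lemma isUnit_det_genInv : IsUnit (genInv K n).det := by
  rw [det_genInv]
  exact IsLocalization.Away.algebraMap_isUnit _

variable {K n} {B : Type*} [CommRing B] [Algebra K B]

/-- Evaluation of polynomials at a matrix. -/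
noncomputable def evalMat (A : Matrix (Fin n) (Fin n) B) :
    MvPolynomial (Fin n × Fin n) K →ₐ[K] B :=
  MvPolynomial.aeval fun p => A p.1 p.2

@[simp] lemma evalMat_X (A : Matrix (Fin n) (Fin n) B) (p : Fin n × Fin n) :
    evalMat (K := K) A (MvPolynomial.X p) = A p.1 p.2 :=
  MvPolynomial.aeval_X _ _

lemma evalMat_det (A : Matrix (Fin n) (Fin n) B) : evalMat A (genMat K n).det = A.det := by
  rw [AlgHom.map_det]
  congr 1
  ext i j
  exact evalMat_X A (i, j)

/-- The algebra homomorphism from the coordinate ring of the general linear group given by an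
invertible matrix. -/
noncomputable def evalGL (A : Matrix (Fin n) (Fin n) B) (hA : IsUnit A.det) :
    GLRing K n →ₐ[K] B :=
  IsLocalization.liftAlgHom (M := Submonoid.powers (genMat K n).det) (f := evalMat A) (by
    rintro ⟨_, m, rfl⟩
    rw [map_pow, evalMat_det]
    exact hA.pow m)

lemma evalGL_algebraMap (A : Matrix (Fin n) (Fin n) B) (hA : IsUnit A.det)
    (p : MvPolynomial (Fin n × Fin n) K) :
    evalGL A hA (algebraMap _ (GLRing K n) p) = evalMat A p :=
  IsLocalization.lift_eq _ _

@[simp] lemma evalGL_genInv (A : Matrix (Fin n) (Fin n) B) (hA : IsUnit A.det) (i j : Fin n) :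
    evalGL A hA (genInv K n i j) = A i j := by
  exact (evalGL_algebraMap A hA _).trans (evalMat_X A (i, j))

lemma GLRing.algHom_ext {f g : GLRing K n →ₐ[K] B}
    (h : ∀ i j, f (genInv K n i j) = g (genInv K n i j)) : f = g := by
  refine IsLocalization.algHom_ext (Submonoid.powers (genMat K n).det) ?_
  refine MvPolynomial.algHom_ext fun p => ?_
  exact h p.1 p.2

variable (K n) in
/-- The endomorphism of the coordinate ring of the general linear group induced by matrix
inversion. -/
noncomputable def invGL : GLRing K n →ₐ[K] GLRing K n :=
  evalGL (genInv K n)⁻¹ (isUnit_nonsing_inv_det _ (isUnit_det_genInv K n))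

lemma invGL_genInv (i j : Fin n) : invGL K n (genInv K n i j) = (genInv K n)⁻¹ i j :=
  evalGL_genInv _ _ i j

@[simp] lemma invGL_invGL (x : GLRing K n) : invGL K n (invGL K n x) = x := by
  suffices h : (invGL K n).comp (invGL K n) = AlgHom.id K _ from DFunLike.congr_fun h x
  refine GLRing.algHom_ext fun i j => ?_
  have h := map_inv_of_isUnit_det (invGL K n : GLRing K n →+* GLRing K n) (isUnit_det_genInv K n)
  have h' : (genInv K n).map (invGL K n : GLRing K n →+* GLRing K n) = (genInv K n)⁻¹ := by
    ext i j
    exact invGL_genInv i j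
  rw [h', nonsing_inv_nonsing_inv _ (isUnit_det_genInv K n)] at h
  rw [AlgHom.comp_apply, invGL_genInv]
  exact congr_fun₂ h i j

variable (K n) in
lemma map_prinMinorIdeal_sub_one (hn : 1 ≤ n) :
    (prinMinorIdeal K n (n - 1)).map (algebraMap _ (GLRing K n)) =
      Ideal.span (Set.range fun i => invGL K n (genInv K n i i)) := by
  have key (i : Fin n) : invGL K n (genInv K n i i) =
      Ring.inverse (genInv K n).det * algebraMap _ (GLRing K n) ((genMat K n).adjugate i i) := by
    rw [invGL_genInv, inv_apply_eq]
    congr 1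
    exact (congr_fun₂ ((algebraMap _ (GLRing K n)).map_adjugate (genMat K n)) i i).symm
  have hu := isUnit_det_genInv K n
  rw [prinMinorIdeal_sub_one_eq_span K n hn, Ideal.map_span]
  apply le_antisymm <;> rw [Ideal.span_le]
  · rintro _ ⟨_, ⟨i, rfl⟩, rfl⟩
    have := Ideal.mul_mem_left _ (genInv K n).det
      (Ideal.subset_span (Set.mem_range_self (f := fun i => invGL K n (genInv K n i i)) i))
    rwa [key, ← mul_assoc, Ring.mul_inverse_cancel _ hu, one_mul] at this
  · rintro _ ⟨i, rfl⟩
    simp only [key]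
    exact Ideal.mul_mem_left _ _ (Ideal.subset_span ⟨_, ⟨i, rfl⟩, rfl⟩)

end Generic

section Truncation

variable (K : Type*) [Field K] (n : ℕ)

/-- The generic matrix with its first `k` diagonal entries replaced by zero. -/
noncomputable def truncMat (k : ℕ) : Matrix (Fin n) (Fin n) (MvPolynomial (Fin n × Fin n) K) :=
  fun i j => if i = j ∧ (i : ℕ) < k then 0 else MvPolynomial.X (i, j)

lemma det_truncMat_ne_zero (hn : 2 ≤ n) (k : ℕ) : (truncMat K n k).det ≠ 0 := by
  obtain ⟨m, rfl⟩ := Nat.exists_eq_add_of_le' hn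
  intro h
  let σ : Equiv.Perm (Fin (m + 2)) := finRotate (m + 2)
  have h1 := (evalMat (K := K) (σ.permMatrix K)).map_det (truncMat K (m + 2) k)
  have h2 : (evalMat (K := K) (σ.permMatrix K)).mapMatrix (truncMat K (m + 2) k) =
      σ.permMatrix K := by
    ext i j
    simp only [AlgHom.mapMatrix_apply, Matrix.map_apply, truncMat]
    split_ifs with hij
    · obtain ⟨rfl, -⟩ := hij
      simp [σ, Equiv.Perm.permMatrix, PEquiv.toMatrix_apply]
    · simp
  rw [h2, h, map_zero, det_permutation] at h1
  rcases Int.units_eq_one_or (Equiv.Perm.sign σ) with hs | hs <;> simp [hs] at h1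

lemma evalMat_truncMat_comp {k l : ℕ} (hkl : k ≤ l) :
    (evalMat (truncMat K n l)).comp (evalMat (truncMat K n k)) =
      evalMat (K := K) (truncMat K n l) := by
  refine MvPolynomial.algHom_ext fun p => ?_
  rw [AlgHom.comp_apply, evalMat_X, evalMat_X]
  by_cases h : p.1 = p.2 ∧ (p.1 : ℕ) < k
  · simp only [truncMat, if_pos h, map_zero, if_pos (And.intro h.1 (h.2.trans_le hkl))]
  · rw [show truncMat K n k p.1 p.2 = MvPolynomial.X p by simp [truncMat, h], evalMat_X]

lemma sub_evalMat_truncMat_mem (p : MvPolynomial (Fin n × Fin n) K) :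
    p - evalMat (truncMat K n n) p ∈ Ideal.span (Set.range fun i => genMat K n i i) := by
  set I := Ideal.span (Set.range fun i => genMat K n i i)
  suffices h : (Ideal.Quotient.mkₐ K I).comp (evalMat (truncMat K n n)) = Ideal.Quotient.mkₐ K I from
    Ideal.Quotient.eq.mp (DFunLike.congr_fun h p).symm
  refine MvPolynomial.algHom_ext fun q => ?_
  rw [AlgHom.comp_apply, evalMat_X]
  by_cases h : q.1 = q.2
  · obtain ⟨i, j⟩ := q
    obtain rfl : i = j := h
    have hmem : (MvPolynomial.X (i, i) : MvPolynomial (Fin n × Fin n) K) ∈ I :=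
      Ideal.subset_span ⟨i, rfl⟩
    simpa [truncMat] using (Ideal.Quotient.eq_zero_iff_mem.mpr hmem).symm
  · simp [truncMat, h]

variable {n}

lemma isUnit_det_truncMat (hn : 2 ≤ n) (k : ℕ) : IsUnit ((truncMat K n k).map
    (algebraMap _ (FractionRing (MvPolynomial (Fin n × Fin n) K)))).det := by
  have h := (algebraMap _ (FractionRing (MvPolynomial (Fin n × Fin n) K))).map_det
    (truncMat K n k)
  rw [RingHom.mapMatrix_apply] at h
  rw [← h, isUnit_iff_ne_zero]
  simpa using det_truncMat_ne_zero K n hn k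

variable (hn : 2 ≤ n)

/-- The homomorphism from the coordinate ring of the general linear group which sends the first
`k` diagonal coordinates to zero. -/
noncomputable def truncHom (k : ℕ) :
    GLRing K n →ₐ[K] FractionRing (MvPolynomial (Fin n × Fin n) K) :=
  evalGL _ (isUnit_det_truncMat K hn k)

lemma truncHom_mk_eq_zero_iff (k : ℕ) (p : MvPolynomial (Fin n × Fin n) K)
    (s : Submonoid.powers (genMat K n).det) :
    truncHom K hn k (IsLocalization.mk' (GLRing K n) p s) = 0 ↔ evalMat (truncMat K n k) p = 0 := by
  have hs : IsUnit (algebraMap _ (GLRing K n) (s : MvPolynomial (Fin n × Fin n) K)) :=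
    IsLocalization.map_units _ s
  have h : truncHom K hn k (algebraMap _ (GLRing K n) p) =
      algebraMap _ _ (evalMat (truncMat K n k) p) := by
    rw [truncHom, evalGL_algebraMap]
    suffices h : evalMat (K := K) ((truncMat K n k).map (algebraMap _ _)) =
        (IsScalarTower.toAlgHom K _ (FractionRing (MvPolynomial (Fin n × Fin n) K))).comp
          (evalMat (truncMat K n k)) from DFunLike.congr_fun h p
    refine MvPolynomial.algHom_ext fun q => ?_
    simp
  rw [← (hs.map (truncHom K hn k)).mul_left_eq_zero, ← map_mul, IsLocalization.mk'_spec, h]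
  simp

lemma ker_truncHom_mono {k l : ℕ} (hkl : k ≤ l) :
    RingHom.ker (truncHom K hn k) ≤ RingHom.ker (truncHom K hn l) := by
  intro x hx
  obtain ⟨p, s, rfl⟩ := IsLocalization.exists_mk'_eq (Submonoid.powers (genMat K n).det) x
  rw [RingHom.mem_ker, truncHom_mk_eq_zero_iff] at hx ⊢
  rw [← evalMat_truncMat_comp K n hkl, AlgHom.comp_apply, hx, map_zero]

lemma genInv_mem_ker_truncHom_iff (k : ℕ) (i : Fin n) :
    genInv K n i i ∈ RingHom.ker (truncHom K hn k) ↔ (i : ℕ) < k := by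
  rw [RingHom.mem_ker, truncHom, evalGL_genInv]
  by_cases h : (i : ℕ) < k <;> simp [truncMat, h]

lemma ker_truncHom_self :
    RingHom.ker (truncHom K hn n) = Ideal.span (Set.range fun i => genInv K n i i) := by
  apply le_antisymm
  · intro x hx
    obtain ⟨p, s, rfl⟩ := IsLocalization.exists_mk'_eq (Submonoid.powers (genMat K n).det) x
    rw [RingHom.mem_ker, truncHom_mk_eq_zero_iff] at hx
    have h := sub_evalMat_truncMat_mem K n p
    rw [hx, sub_zero] at h
    have h' := Ideal.mem_map_of_mem (algebraMap _ (GLRing K n)) h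
    rw [Ideal.map_span, ← Set.range_comp] at h'
    rw [IsLocalization.mk'_eq_mul_mk'_one]
    exact Ideal.mul_mem_right _ _ h'
  · rw [Ideal.span_le]
    rintro _ ⟨i, rfl⟩
    exact (genInv_mem_ker_truncHom_iff K hn n i).mpr i.2

/-- The prime ideals of the inverse matrices whose first `k` diagonal entries vanish. -/
noncomputable def inverseDiagPrime (k : ℕ) : PrimeSpectrum (GLRing K n) :=
  ⟨RingHom.ker ((truncHom K hn k).comp (invGL K n)), RingHom.ker_isPrime _⟩

lemma mem_inverseDiagPrime (k : ℕ) (x : GLRing K n) :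
    x ∈ (inverseDiagPrime K hn k).asIdeal ↔ invGL K n x ∈ RingHom.ker (truncHom K hn k) :=
  Iff.rfl

lemma inverseDiagPrime_lt_succ {k : ℕ} (hk : k < n) :
    inverseDiagPrime K hn k < inverseDiagPrime K hn (k + 1) := by
  refine (PrimeSpectrum.asIdeal_lt_asIdeal _ _).mp <| SetLike.lt_iff_le_and_exists.mpr
    ⟨fun x hx => ker_truncHom_mono K hn k.le_succ hx, invGL K n (genInv K n ⟨k, hk⟩ ⟨k, hk⟩), ?_, ?_⟩
  · refine (mem_inverseDiagPrime K hn _ _).mpr ?_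
    rw [invGL_invGL, genInv_mem_ker_truncHom_iff]
    exact k.lt_succ_self
  · refine fun h => ?_
    have h' := (mem_inverseDiagPrime K hn _ _).mp h
    rw [invGL_invGL, genInv_mem_ker_truncHom_iff] at h'
    exact lt_irrefl _ h'

lemma le_height_inverseDiagPrime {k : ℕ} (hk : k ≤ n) :
    (k : ℕ∞) ≤ Order.height (inverseDiagPrime K hn k) := by
  induction k with
  | zero => simp
  | succ k ih =>
    push_cast
    exact (add_le_add_left (ih (by lia)) 1).trans
      (Order.height_add_one_le (inverseDiagPrime_lt_succ K hn hk))

lemma inverseDiagPrime_self_asIdeal : (inverseDiagPrime K hn n).asIdeal =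
    Ideal.span (Set.range fun i => invGL K n (genInv K n i i)) := by
  apply le_antisymm
  · intro x hx
    rw [mem_inverseDiagPrime, ker_truncHom_self] at hx
    have h := Ideal.mem_map_of_mem (invGL K n) hx
    rwa [invGL_invGL, Ideal.map_span, ← Set.range_comp] at h
  · rw [Ideal.span_le]
    rintro _ ⟨i, rfl⟩
    refine (mem_inverseDiagPrime K hn _ _).mpr ?_
    rw [invGL_invGL, genInv_mem_ker_truncHom_iff]
    exact i.2

lemma height_inverseDiagPrime_self : Order.height (inverseDiagPrime K hn n) = n := by
  refine le_antisymm ?_ (le_height_inverseDiagPrime K hn le_rfl)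
  have hnoeth : IsNoetherianRing (GLRing K n) :=
    IsLocalization.isNoetherianRing (Submonoid.powers (genMat K n).det) _ inferInstance
  have hmin : (inverseDiagPrime K hn n).asIdeal ∈
      (Ideal.span (Set.range fun i => invGL K n (genInv K n i i))).minimalPrimes := by
    rw [← inverseDiagPrime_self_asIdeal K hn, Ideal.minimalPrimes_eq_subsingleton_self]
    rfl
  have h := Ideal.height_le_card_of_mem_minimalPrimes_span (Set.finite_range _) hmin
  rw [PrimeSpectrum.height_eq_orderHeight] at h
  refine h.trans (Nat.cast_le.mpr ?_)
  rw [← Set.image_univ]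
  exact (Set.ncard_image_le Set.finite_univ).trans (by simp)

end Truncation

/-- For `n ≥ 2`, the extension `P_{n-1}·S_Δ` of the principal `(n-1)`-minor ideal
to the localization `S_Δ = S[1/Δ]` is a prime ideal of `S_Δ` of height `n`.
(Equivalently, the locally closed set `Y_{n,n,n-1}` of invertible matrices with
vanishing principal `(n-1)`-minors is irreducible of codimension `n`.) -/
theorem prinMinorIdeal_sub_one_localized_prime (K : Type*) [Field K] [IsAlgClosed K]
    (n : ℕ) (hn : 2 ≤ n) :
    (Ideal.map (algebraMap (MvPolynomial (Fin n × Fin n) K)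
        (Localization.Away (genMat K n).det)) (prinMinorIdeal K n (n - 1))).IsPrime ∧
      idealHeight (Ideal.map (algebraMap (MvPolynomial (Fin n × Fin n) K)
        (Localization.Away (genMat K n).det)) (prinMinorIdeal K n (n - 1))) =
        (n : ℕ∞) := by
  rw [map_prinMinorIdeal_sub_one K n (by lia), ← inverseDiagPrime_self_asIdeal K hn]
  exact ⟨(inverseDiagPrime K hn n).isPrime,
    (idealHeight_eq_height _).trans (height_inverseDiagPrime_self K hn)⟩
end

section
/- For all n ≥ 4, the minimal primes of the ideal P_{n−1} generated by the principal (n−1)-minors of the generic n×n matrix are exactly the determinantal ideal I_{n−1} and the contracted ideal Q_{n−1}; that is, the set of minimal primes over P_{n−1} equals {I_{n−1}, Q_{n−1}}. -/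
open Matrix

/-- `I_t`: the determinantal ideal generated by all `t × t` minors of the generic
matrix. -/
noncomputable def detIdeal (K : Type*) [Field K] (n t : ℕ) :
    Ideal (MvPolynomial (Fin n × Fin n) K) :=
  Ideal.span {p | ∃ (I J : Finset (Fin n)) (hI : I.card = t) (hJ : J.card = t),
    p = (Matrix.of fun a b : Fin t =>
        genMat K n (I.orderIsoOfFin hI a) (J.orderIsoOfFin hJ b)).det}

/-- `Q_{n-1}`: the contraction to `S = K[X]` of the extension of `P_{n-1}` to the
localization `S_Δ = S[1/Δ]`, where `Δ = det X`. -/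
noncomputable def Qideal (K : Type*) [Field K] (n : ℕ) :
    Ideal (MvPolynomial (Fin n × Fin n) K) :=
  Ideal.comap (algebraMap (MvPolynomial (Fin n × Fin n) K)
      (Localization.Away (genMat K n).det))
    (Ideal.map (algebraMap (MvPolynomial (Fin n × Fin n) K)
      (Localization.Away (genMat K n).det)) (prinMinorIdeal K n (n - 1)))

theorem finrank_span_col_le_iff {L m l : Type*} [Field L] [Finite m]
    (M : Matrix m l L) (s : Set l) [Finite l] (d : ℕ) :
    Module.finrank L (Submodule.span L (M.col '' s)) ≤ d ↔
      ∀ k, d < k → ∀ (ρ : Fin k → m) (κ : Fin k → l), (∀ b, κ b ∈ s) →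
        (M.submatrix ρ κ).det = 0 := by
  cases nonempty_fintype m
  cases nonempty_fintype l
  constructor
  · intro h k hk ρ κ hκ
    by_contra hdet
    have hcol : LinearIndependent L (M.submatrix ρ κ).col :=
      Matrix.linearIndependent_cols_iff_isUnit.2
        ((Matrix.isUnit_iff_isUnit_det _).2 (Ne.isUnit hdet))
    have hli : LinearIndependent L (M.col ∘ κ) :=
      LinearIndependent.of_comp (LinearMap.funLeft L L ρ) hcol
    have h1 := finrank_span_eq_card hli
    have h2 : Submodule.span L (Set.range (M.col ∘ κ)) ≤ Submodule.span L (M.col '' s) := by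
      apply Submodule.span_mono
      rintro _ ⟨b, rfl⟩
      exact ⟨κ b, hκ b, rfl⟩
    have h3 := Submodule.finrank_mono h2
    rw [h1, Fintype.card_fin] at h3
    omega
  · intro h
    by_contra! hlt
    obtain ⟨f, hf, -, hli⟩ := Submodule.exists_fun_fin_finrank_span_eq L (M.col '' s)
    choose κ hκ hfκ using hf
    have hrank : Module.finrank L
        (Submodule.span L (Set.range (M.submatrix id κ).row)) =
        Module.finrank L (Submodule.span L (M.col '' s)) := by
      rw [← Matrix.rank_eq_finrank_span_row, Matrix.rank_eq_finrank_span_cols]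
      have : (M.submatrix id κ).col = f := funext fun i => by rw [← hfκ i]; rfl
      rw [this, finrank_span_eq_card hli, Fintype.card_fin]
    obtain ⟨g, hg, -, hgli⟩ := Submodule.exists_fun_fin_finrank_span_eq L
      (Set.range (M.submatrix id κ).row)
    choose ρ hρ using hg
    have hgli' := hgli.comp (Fin.cast hrank.symm) (Fin.cast_injective _)
    have hrow : (M.submatrix (ρ ∘ Fin.cast hrank.symm) κ).row = g ∘ Fin.cast hrank.symm :=
      funext fun i => by rw [Function.comp, ← hρ]; rfl
    rw [← hrow, Matrix.linearIndependent_rows_iff_isUnit, Matrix.isUnit_iff_isUnit_det,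
      h _ hlt _ _ hκ] at hgli'
    simp at hgli'

/-- The ideal expressing that, for every `c`, the columns of the generic matrix with index at
most `c` span a space of dimension at most `β c`, that the rows above `r` vanish, and that
row `r` vanishes in the columns before `j`. -/
noncomputable def stairIdeal (K : Type*) [Field K] {n : ℕ} (β : Fin n → ℕ) (r j : ℕ) :
    Ideal (MvPolynomial (Fin n × Fin n) K) :=
  Ideal.span ({f | ∃ i c : Fin n, (i.1 < r ∨ i.1 = r ∧ c.1 < j) ∧ f = MvPolynomial.X (i, c)} ∪
    {f | ∃ (c : Fin n) (k : ℕ) (ρ κ : Fin k → Fin n), β c < k ∧ (∀ b, κ b ≤ c) ∧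
      f = ((genMat K n).submatrix ρ κ).det})

section stairIdeal

variable {K : Type*} [Field K] {n : ℕ} {β τ : Fin n → ℕ} {r j : ℕ}

theorem X_mem_stairIdeal {i c : Fin n} (h : i.1 < r ∨ i.1 = r ∧ c.1 < j) :
    MvPolynomial.X (i, c) ∈ stairIdeal K β r j :=
  Ideal.subset_span (Or.inl ⟨i, c, h, rfl⟩)

theorem minor_mem_stairIdeal {k : ℕ} (ρ κ : Fin k → Fin n) (c : Fin n) (hk : β c < k)
    (hκ : ∀ b, κ b ≤ c) :
    ((genMat K n).submatrix ρ κ).det ∈ stairIdeal K β r j :=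
  Ideal.subset_span (Or.inr ⟨c, k, ρ, κ, hk, hκ, rfl⟩)

theorem stairIdeal_le_iff {I : Ideal (MvPolynomial (Fin n × Fin n) K)} :
    stairIdeal K β r j ≤ I ↔
      (∀ i c : Fin n, (i.1 < r ∨ i.1 = r ∧ c.1 < j) → MvPolynomial.X (i, c) ∈ I) ∧
      ∀ (c : Fin n) (k : ℕ) (ρ κ : Fin k → Fin n), β c < k → (∀ b, κ b ≤ c) →
        ((genMat K n).submatrix ρ κ).det ∈ I := by
  constructor
  · exact fun h => ⟨fun i c hic => h (X_mem_stairIdeal hic),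
      fun c k ρ κ hk hκ => h (minor_mem_stairIdeal ρ κ c hk hκ)⟩
  · rintro ⟨h1, h2⟩
    refine Ideal.span_le.2 ?_
    rintro _ (⟨i, c, h, rfl⟩ | ⟨c, k, ρ, κ, hk, hκ, rfl⟩)
    · exact h1 i c h
    · exact h2 c k ρ κ hk hκ

theorem map_det_submatrix_genMat {R : Type*} [CommRing R] (φ : MvPolynomial (Fin n × Fin n) K →+* R)
    {k : ℕ} (ρ κ : Fin k → Fin n) :
    φ ((genMat K n).submatrix ρ κ).det =
      (Matrix.submatrix (Matrix.of fun i c => φ (MvPolynomial.X (i, c))) ρ κ).det := by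
  rw [RingHom.map_det]; rfl

/-- The `L`-points of the vanishing locus of `stairIdeal`. -/
theorem stairIdeal_le_ker_iff {L : Type*} [Field L] (φ : MvPolynomial (Fin n × Fin n) K →+* L) :
    stairIdeal K β r j ≤ RingHom.ker φ ↔
      (∀ i c : Fin n, (i.1 < r ∨ i.1 = r ∧ c.1 < j) → φ (MvPolynomial.X (i, c)) = 0) ∧
      ∀ c : Fin n, Module.finrank L (Submodule.span L
        ((Matrix.of fun i c => φ (MvPolynomial.X (i, c))).col '' Set.Iic c)) ≤ β c := by
  simp only [stairIdeal_le_iff, RingHom.mem_ker, finrank_span_col_le_iff,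
    map_det_submatrix_genMat, Set.mem_Iic]
  tauto

theorem stairIdeal_sup_span_X (hr : r < n) (hj : j < n) :
    stairIdeal K β r j ⊔ Ideal.span {MvPolynomial.X (⟨r, hr⟩, ⟨j, hj⟩)} =
      stairIdeal K β r (j + 1) := by
  apply le_antisymm
  · refine sup_le (stairIdeal_le_iff.2 ⟨fun i c h => X_mem_stairIdeal (by omega),
      fun c k ρ κ hk hκ => minor_mem_stairIdeal ρ κ c hk hκ⟩) ?_
    rw [Ideal.span_singleton_le_iff_mem]
    exact X_mem_stairIdeal (by simp)
  · refine stairIdeal_le_iff.2 ⟨fun i c h => ?_, fun c k ρ κ hk hκ =>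
      Ideal.mem_sup_left (minor_mem_stairIdeal ρ κ c hk hκ)⟩
    by_cases hc : i.1 = r ∧ c.1 = j
    · obtain ⟨rfl, rfl⟩ := hc
      exact Ideal.mem_sup_right (Ideal.mem_span_singleton_self _)
    · exact Ideal.mem_sup_left (X_mem_stairIdeal (by omega))

theorem stairIdeal_row_end : stairIdeal K β r n = stairIdeal K β (r + 1) 0 := by
  apply le_antisymm <;>
  exact stairIdeal_le_iff.2 ⟨fun i c h => X_mem_stairIdeal (by omega),
      fun c k ρ κ hk hκ => minor_mem_stairIdeal ρ κ c hk hκ⟩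

theorem stairIdeal_eq_idealOfVars (hr : n ≤ r) :
    stairIdeal K β r j = MvPolynomial.idealOfVars (Fin n × Fin n) K := by
  apply le_antisymm
  · rw [stairIdeal_le_iff]
    refine ⟨fun i c _ => Ideal.subset_span ⟨_, rfl⟩, fun c k ρ κ hk hκ => ?_⟩
    obtain ⟨k, rfl⟩ : ∃ l, k = l + 1 := ⟨k - 1, by omega⟩
    rw [Matrix.det_succ_row_zero]
    exact Ideal.sum_mem _ fun b _ => Ideal.mul_mem_right _ _
      (Ideal.mul_mem_left _ _ (Ideal.subset_span ⟨_, rfl⟩))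
  · refine Ideal.span_le.2 ?_
    rintro _ ⟨⟨i, c⟩, rfl⟩
    exact X_mem_stairIdeal (Or.inl (by omega))

theorem isHomogeneous_det_submatrix_genMat {k : ℕ} (ρ κ : Fin k → Fin n) :
    ((genMat K n).submatrix ρ κ).det.IsHomogeneous k := by
  rw [Matrix.det_apply]
  refine MvPolynomial.IsHomogeneous.sum _ _ _ fun σ _ => ?_
  have h : (∏ i, (genMat K n).submatrix ρ κ (σ i) i).IsHomogeneous (∑ _i : Fin k, 1) :=
    MvPolynomial.IsHomogeneous.prod _ _ _ fun i _ => MvPolynomial.isHomogeneous_X _ _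
  rw [Finset.sum_const, Finset.card_univ, Fintype.card_fin, smul_eq_mul, mul_one] at h
  rcases Int.units_eq_one_or (Equiv.Perm.sign σ) with hs | hs
  · simpa [hs] using h
  · simpa [hs] using h.neg

open MvPolynomial in
attribute [local instance] MvPolynomial.gradedAlgebra in
theorem homogeneousComponent_mem_stairIdeal {f : MvPolynomial (Fin n × Fin n) K}
    (hf : f ∈ stairIdeal K β r j) (d : ℕ) :
    homogeneousComponent d f ∈ stairIdeal K β r j := by
  have h : (stairIdeal K β r j).IsHomogeneous (homogeneousSubmodule (Fin n × Fin n) K) := by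
    refine Ideal.homogeneous_span _ _ ?_
    rintro _ (⟨i, c, h, rfl⟩ | ⟨c, k, ρ, κ, hk, hκ, rfl⟩)
    · exact ⟨1, isHomogeneous_X _ _⟩
    · exact ⟨k, isHomogeneous_det_submatrix_genMat ρ κ⟩
  have := h d hf
  rwa [← decomposition.decompose'_apply]

end stairIdeal

/-- Graded Nakayama criterion for an ideal to be radical. -/
theorem isRadical_of_sup_span_X {σ K : Type*} [Field K]
    {I : Ideal (MvPolynomial σ K)}
    (hI : ∀ f ∈ I, ∀ d, MvPolynomial.homogeneousComponent d f ∈ I) (s : σ)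
    (hsup : (I ⊔ Ideal.span {MvPolynomial.X s}).IsRadical)
    (hreg : ∀ f, MvPolynomial.X s * f ∈ I.radical → f ∈ I.radical) : I.IsRadical := by
  have hstep : ∀ k : ℕ, ∀ f ∈ I.radical, ∃ i ∈ I, ∃ g ∈ I.radical,
      f = i + MvPolynomial.X s ^ k * g := by
    intro k
    induction k with
    | zero => exact fun f hf => ⟨0, I.zero_mem, f, hf, by simp⟩
    | succ k ih =>
      intro f hf
      obtain ⟨i, hi, g, hg, rfl⟩ := ih f hf
      have hg' := hsup (Ideal.radical_mono le_sup_left hg)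
      obtain ⟨i', hi', y, hy, hiy⟩ := Submodule.mem_sup.1 hg'
      obtain ⟨z, rfl⟩ := Ideal.mem_span_singleton'.1 hy
      refine ⟨i + MvPolynomial.X s ^ k * i', I.add_mem hi (I.mul_mem_left _ hi'), z,
        hreg z ?_, by rw [← hiy]; ring⟩
      have : MvPolynomial.X s * z = g - i' := by rw [← hiy]; ring
      rw [this]
      exact sub_mem hg (Ideal.le_radical hi')
  intro f hf
  rw [← MvPolynomial.sum_homogeneousComponent f]
  refine Ideal.sum_mem _ fun d _ => ?_
  obtain ⟨i, hi, g, -, hfi⟩ := hstep (d + 1) f hf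
  have h0 : MvPolynomial.homogeneousComponent d (MvPolynomial.X s ^ (d + 1) * g) = 0 := by
    have hmem : MvPolynomial.X s ^ (d + 1) * g ∈ MvPolynomial.idealOfVars σ K ^ (d + 1) :=
      Ideal.mul_mem_right _ _ (Ideal.pow_mem_pow (Ideal.subset_span (Set.mem_range_self s)) _)
    rw [MvPolynomial.mem_pow_idealOfVars_iff'] at hmem
    ext m
    rw [MvPolynomial.coeff_homogeneousComponent, MvPolynomial.coeff_zero]
    split_ifs with hm
    · exact hmem m (by omega)
    · rfl
  rw [hfi, map_add, h0, add_zero]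
  exact hI i hi d

theorem isRadical_of_le_of_mul_mem {R : Type*} [CommRing R] {I J : Ideal R} {x : R}
    (hIJ : I ≤ J) (hJ : J.IsRadical) (hreg : ∀ f, x * f ∈ J → f ∈ J)
    (hmul : ∀ f ∈ J, x * f ∈ I) (hsup : (I ⊔ Ideal.span {x}).IsRadical) : I.IsRadical := by
  intro f hf
  obtain ⟨i, hi, y, hy, rfl⟩ := Submodule.mem_sup.1 (hsup (Ideal.radical_mono le_sup_left hf))
  obtain ⟨z, rfl⟩ := Ideal.mem_span_singleton.1 hy
  have hxz : x * z ∈ J := by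
    have h := sub_mem (hJ (Ideal.radical_mono hIJ hf)) (hIJ hi)
    rwa [add_sub_cancel_left] at h
  exact I.add_mem hi (hmul z (hreg z hxz))

theorem finrank_span_insert_le {L V : Type*} [Field L] [AddCommGroup V] [Module L V]
    [FiniteDimensional L V] (w : V) (s : Set V) :
    Module.finrank L (Submodule.span L (insert w s)) ≤
      Module.finrank L (Submodule.span L s) + 1 := by
  rw [Submodule.span_insert, add_comm]
  have h := finrank_span_le_card (R := L) ({w} : Set V)
  rw [Set.toFinset_singleton, Finset.card_singleton] at h
  exact (Submodule.finrank_add_le_finrank_add_finrank _ _).trans (Nat.add_le_add_right h _)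

section deformation

open Polynomial

variable {L : Type*} [Field L] {n : ℕ}

/-- The matrix obtained from `M` by adding `t w` to column `j` and then applying
`v ↦ v + t y(v) e_r` to every column. -/
noncomputable def transvectionCurve (M : Matrix (Fin n) (Fin n) L)
    (y : (Fin n → L) →ₗ[L] L) (w : Fin n → L) (r j : Fin n) : Matrix (Fin n) (Fin n) L[X] :=
  fun i c => C (M i c) + (if c = j then X * C (w i) else 0) +
    if i = r then X * (C (y (M.col c)) + if c = j then X * C (y w) else 0) else 0

variable {M : Matrix (Fin n) (Fin n) L} {y : (Fin n → L) →ₗ[L] L} {w : Fin n → L} {r j : Fin n}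

theorem transvectionCurve_map_eval_zero :
    (transvectionCurve M y w r j).map (eval 0) = M := by
  ext i c
  simp only [Matrix.map_apply, transvectionCurve]
  split_ifs <;> simp

theorem transvectionCurve_apply_ne_zero (h : y w ≠ 0 ∨ w r + y (M.col j) ≠ 0) :
    transvectionCurve M y w r j r j ≠ 0 := by
  intro h0
  have h1 := congrArg (coeff · 1) h0
  have h2 := congrArg (coeff · 2) h0
  simp only [transvectionCurve, if_true, coeff_add, coeff_X_mul, mul_add, coeff_zero] at h1 h2
  simp [coeff_C] at h1 h2
  tauto

theorem col_transvectionCurve_map_eval (t : L) (c : Fin n) :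
    ((transvectionCurve M y w r j).map (eval t)).col c =
      (LinearMap.transvection (t • y) (Pi.single r 1))
        (M.col c + if c = j then t • w else 0) := by
  ext i
  simp only [Matrix.col_apply, Matrix.map_apply, transvectionCurve, LinearMap.transvection.apply,
    LinearMap.smul_apply, Pi.add_apply,
    Pi.smul_apply, Pi.single_apply, map_add, smul_eq_mul]
  split_ifs <;> simp <;> ring

theorem finrank_transvectionCurve_le_of_lt (t : L) {c : Fin n} (hc : c < j) :
    Module.finrank L (Submodule.span L
      (((transvectionCurve M y w r j).map (eval t)).col '' Set.Iic c)) ≤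
    Module.finrank L (Submodule.span L (M.col '' Set.Iic c)) := by
  refine le_trans (Submodule.finrank_mono ?_) (Submodule.finrank_map_le
    (LinearMap.transvection (t • y) (Pi.single r 1)) _)
  rw [Submodule.span_le]
  rintro _ ⟨d, hd, rfl⟩
  rw [Set.mem_Iic] at hd
  rw [col_transvectionCurve_map_eval, if_neg (hd.trans_lt hc).ne, add_zero]
  exact Submodule.mem_map_of_mem (Submodule.subset_span ⟨d, hd, rfl⟩)

theorem finrank_transvectionCurve_le (t : L) (c : Fin n) :
    Module.finrank L (Submodule.span L
      (((transvectionCurve M y w r j).map (eval t)).col '' Set.Iic c)) ≤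
    Module.finrank L (Submodule.span L (insert w (M.col '' Set.Iic c))) := by
  refine le_trans (Submodule.finrank_mono ?_) (Submodule.finrank_map_le
    (LinearMap.transvection (t • y) (Pi.single r 1)) _)
  rw [Submodule.span_le]
  rintro _ ⟨d, hd, rfl⟩
  rw [col_transvectionCurve_map_eval]
  refine Submodule.mem_map_of_mem (Submodule.add_mem _
    (Submodule.subset_span (Or.inr ⟨d, hd, rfl⟩)) ?_)
  split_ifs
  · exact Submodule.smul_mem _ _ (Submodule.subset_span (Or.inl rfl))
  · exact Submodule.zero_mem _

/-- A matrix satisfying the conditions cut out by a `stairIdeal` whose bounds jump at column `j`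
deforms, within that locus, to a matrix with nonzero entry at `(r, j)`. -/
theorem exists_stair_deformation {β : Fin n → ℕ} (hβ : Monotone β) (hpos : 0 < β j)
    (hjump : ∀ c < j, β c < β j)
    (hzero : ∀ i c : Fin n, (i.1 < r.1 ∨ i.1 = r.1 ∧ c.1 < j.1) → M i c = 0)
    (hrank : ∀ c, Module.finrank L (Submodule.span L (M.col '' Set.Iic c)) ≤ β c) :
    ∃ N : Matrix (Fin n) (Fin n) L[X], N.map (eval 0) = M ∧ N r j ≠ 0 ∧ ∀ t,
      (∀ i c : Fin n, (i.1 < r.1 ∨ i.1 = r.1 ∧ c.1 < j.1) → (N i c).eval t = 0) ∧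
      ∀ c, Module.finrank L (Submodule.span L ((N.map (eval t)).col '' Set.Iic c)) ≤ β c := by
  suffices h : ∃ (y : (Fin n → L) →ₗ[L] L) (w : Fin n → L),
      (y w ≠ 0 ∨ w r + y (M.col j) ≠ 0) ∧ (∀ c < j, y (M.col c) = 0) ∧ (∀ i < r, w i = 0) ∧
      ∀ c, j ≤ c → Module.finrank L
        (Submodule.span L (insert w (M.col '' Set.Iic c))) ≤ β c by
    obtain ⟨y, w, hne, hy, hw, hyw⟩ := h
    refine ⟨transvectionCurve M y w r j, transvectionCurve_map_eval_zero,
      transvectionCurve_apply_ne_zero hne, fun t => ⟨fun i c hic => ?_, fun c => ?_⟩⟩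
    · rw [transvectionCurve, hzero i c hic]
      rcases hic with hi | ⟨hi, hc⟩
      · have hir : i < r := hi
        rw [if_neg hir.ne, hw i hir]
        simp
      · have hcj : c < j := hc
        rw [if_neg hcj.ne, if_neg hcj.ne, hy c hcj]
        simp
    · rcases lt_or_ge c j with hc | hc
      · exact (finrank_transvectionCurve_le_of_lt t hc).trans (hrank c)
      · exact (finrank_transvectionCurve_le t c).trans (hyw c hc)
  by_cases hall : ∀ c, j ≤ c →
      Module.finrank L (Submodule.span L (M.col '' Set.Iic c)) < β c
  · refine ⟨0, Pi.single r 1, Or.inr (by simp), fun _ _ => rfl,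
      fun i hi => by simp [hi.ne], fun c hc => ?_⟩
    exact (finrank_span_insert_le _ _).trans (hall c hc)
  · push Not at hall
    obtain ⟨c₁, ⟨hjc, hc₁⟩, hmin⟩ := WellFounded.has_min (wellFounded_lt (α := Fin n))
      {c | j ≤ c ∧ β c ≤ Module.finrank L (Submodule.span L (M.col '' Set.Iic c))} hall
    have hmin' : ∀ c, j ≤ c → c < c₁ →
        Module.finrank L (Submodule.span L (M.col '' Set.Iic c)) < β c := by
      intro c hc hlt
      by_contra! h
      exact hmin c ⟨hc, h⟩ hlt
    have hnot : M.col c₁ ∉ Submodule.span L (M.col '' Set.Iio c₁) := by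
      intro hmem
      have hle : Submodule.span L (M.col '' Set.Iic c₁) ≤
          Submodule.span L (M.col '' Set.Iio c₁) := by
        rw [Submodule.span_le]
        rintro _ ⟨d, hd, rfl⟩
        rcases (Set.mem_Iic.1 hd).eq_or_lt with rfl | hd
        · exact hmem
        · exact Submodule.subset_span ⟨d, hd, rfl⟩
      have hfin := hc₁.trans (Submodule.finrank_mono hle)
      have hpos₁ := hpos.trans_le (hβ hjc)
      rcases Nat.eq_zero_or_pos c₁.1 with h0 | h0
      · have : Set.Iio c₁ = ∅ := by
          ext d
          simp [Fin.lt_def, h0]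
        rw [this, Set.image_empty, Submodule.span_empty, finrank_bot] at hfin
        omega
      · have hlt : c₁.1 - 1 < n := by omega
        have : Set.Iio c₁ = Set.Iic ⟨c₁.1 - 1, hlt⟩ := by
          ext d
          simp only [Set.mem_Iio, Set.mem_Iic, Fin.lt_def, Fin.le_def]
          omega
        rw [this] at hfin
        have hlt₁ : (⟨c₁.1 - 1, hlt⟩ : Fin n) < c₁ := by
          rw [Fin.lt_def]
          exact Nat.sub_one_lt h0.ne'
        rcases lt_or_ge (⟨c₁.1 - 1, hlt⟩ : Fin n) j with hc | hc
        · have := hrank ⟨c₁.1 - 1, hlt⟩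
          have := hjump _ hc
          have := hβ hjc
          omega
        · have := hmin' _ hc hlt₁
          have := hβ hlt₁.le
          omega
    obtain ⟨y, hy, hker⟩ := Submodule.exists_le_ker_of_notMem hnot
    refine ⟨y, M.col c₁, Or.inl hy, fun c hc => ?_, fun i hi => hzero i c₁ (Or.inl hi),
      fun c hc => ?_⟩
    · exact hker (Submodule.subset_span ⟨c, hc.trans_le hjc, rfl⟩)
    · rcases lt_or_ge c c₁ with h | h
      · exact (finrank_span_insert_le _ _).trans (hmin' c hc h)
      · rw [Set.insert_eq_of_mem (Set.mem_image_of_mem _ (Set.mem_Iic.2 h))]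
        exact hrank c

end deformation

theorem exists_field_ker_eq {R : Type*} [CommRing R] (p : Ideal R) [p.IsPrime] :
    RingHom.ker ((algebraMap (R ⧸ p) (FractionRing (R ⧸ p))).comp (Ideal.Quotient.mk p)) = p := by
  ext x
  rw [RingHom.mem_ker, RingHom.comp_apply, FaithfulSMul.algebraMap_eq_zero_iff,
    Ideal.Quotient.eq_zero_iff_mem]

section stairIdeal

open MvPolynomial

variable {K : Type*} [Field K] {n : ℕ} {β : Fin n → ℕ}

theorem mem_radical_stairIdeal_of_X_mul_mem [Infinite K] (hβ : Monotone β) {r j : Fin n}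
    (hpos : 0 < β j) (hjump : ∀ c < j, β c < β j) {f : MvPolynomial (Fin n × Fin n) K}
    (hf : X (r, j) * f ∈ (stairIdeal K β r j).radical) : f ∈ (stairIdeal K β r j).radical := by
  rw [Ideal.radical_eq_sInf, Submodule.mem_sInf]
  rintro p ⟨hp, hprime⟩
  set φ := (algebraMap (_ ⧸ p) (FractionRing (_ ⧸ p))).comp (Ideal.Quotient.mk p) with hφ
  have hker : RingHom.ker φ = p := exists_field_ker_eq p
  rw [← hker, stairIdeal_le_ker_iff] at hp
  obtain ⟨N, hN0, hNrj, hN⟩ := exists_stair_deformation hβ hpos hjump hp.1 hp.2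
  have : Infinite (FractionRing (MvPolynomial (Fin n × Fin n) K ⧸ p)) :=
    Infinite.of_injective _ (φ.comp (C : K →+* _)).injective
  let ψ : MvPolynomial (Fin n × Fin n) K →+* Polynomial (FractionRing (_ ⧸ p)) :=
    eval₂Hom (Polynomial.C.comp (φ.comp C)) fun q => N q.1 q.2
  have hψX : ∀ i c, ψ (X (i, c)) = N i c := fun i c => eval₂Hom_X' _ _ _
  have hmul : N r j * ψ f = 0 := by
    refine Polynomial.funext fun t => ?_
    have hle : stairIdeal K β r j ≤ RingHom.ker ((Polynomial.evalRingHom t).comp ψ) := by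
      have hmap : (Matrix.of fun i c => (Polynomial.evalRingHom t).comp ψ (X (i, c))) =
          N.map (Polynomial.eval t) := by
        ext i c
        simp [hψX]
      rw [stairIdeal_le_ker_iff, hmap]
      refine ⟨fun i c h => ?_, (hN t).2⟩
      rw [RingHom.comp_apply, hψX]
      exact (hN t).1 i c h
    have hmem := (RingHom.ker_isPrime _).isRadical (Ideal.radical_mono hle hf)
    rw [RingHom.mem_ker, RingHom.comp_apply, map_mul, hψX] at hmem
    simpa using hmem
  have hψf := (mul_eq_zero.1 hmul).resolve_left hNrj
  have hcomp : (Polynomial.evalRingHom 0).comp ψ = φ := by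
    refine MvPolynomial.ringHom_ext (fun a => ?_) fun ⟨i, c⟩ => ?_
    · simp [ψ]
    · rw [RingHom.comp_apply, hψX]
      exact congrFun (congrFun hN0 i) c
  rw [← hker, RingHom.mem_ker, ← hcomp, RingHom.comp_apply, hψf, map_zero]

theorem stairIdeal_isRadical_of_succ [Infinite K] (hβ : Monotone β) (r j : Fin n)
    (ih : ∀ τ : Fin n → ℕ, Monotone τ → (stairIdeal K τ r (j + 1)).IsRadical) :
    (stairIdeal K β r j).IsRadical := by
  rcases Nat.eq_zero_or_pos (β j) with h0 | hpos
  · have hX : X (r, j) ∈ stairIdeal K β r j := by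
      have h := minor_mem_stairIdeal (K := K) (β := β) (r := r) (j := j)
        (fun _ : Fin 1 => r) (fun _ => j) j (by omega) fun _ => le_rfl
      rwa [Matrix.det_fin_one] at h
    have := stairIdeal_sup_span_X (K := K) (β := β) r.2 j.2
    rw [sup_eq_left.2 (Ideal.span_singleton_le_iff_mem _ |>.2 hX)] at this
    rw [this]
    exact ih β hβ
  · let τ : Fin n → ℕ := fun c => if c < j then min (β c) (β j - 1) else β c
    have hτj : τ j = β j := if_neg (lt_irrefl j)
    have hτ : Monotone τ := by
      intro c d hcd
      have h1 := hβ hcd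
      simp only [τ]
      split_ifs with h2 h3 h3
      · omega
      · exact (min_le_left _ _).trans h1
      · exact absurd (hcd.trans_lt h3) h2
      · exact h1
    have hreg : ∀ f, X (r, j) * f ∈ (stairIdeal K τ r j).radical →
        f ∈ (stairIdeal K τ r j).radical := by
      refine fun f => mem_radical_stairIdeal_of_X_mul_mem hτ (by omega) fun c hc => ?_
      rw [hτj]
      simp only [τ, if_pos hc]
      omega
    have hrad : (stairIdeal K τ r j).IsRadical := by
      refine isRadical_of_sup_span_X (fun f hf d => homogeneousComponent_mem_stairIdeal hf d)
        (r, j) ?_ hreg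
      have := stairIdeal_sup_span_X (K := K) (β := τ) r.2 j.2
      rw [this]
      exact ih τ hτ
    rw [hrad.radical] at hreg
    have hle : stairIdeal K β r j ≤ stairIdeal K τ r j := by
      refine stairIdeal_le_iff.2 ⟨fun i c h => X_mem_stairIdeal h, fun c k ρ κ hk hκ =>
        minor_mem_stairIdeal ρ κ c (lt_of_le_of_lt ?_ hk) hκ⟩
      simp only [τ]
      split_ifs <;> omega
    refine isRadical_of_le_of_mul_mem hle hrad hreg ?_ ?_ (x := X (r, j))
    · suffices h : stairIdeal K τ r j ≤
          Submodule.comap (LinearMap.mulLeft (MvPolynomial (Fin n × Fin n) K) (X (r, j)))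
            (stairIdeal K β r j) from fun f hf => h hf
      refine stairIdeal_le_iff.2 ⟨fun i c h => Ideal.mul_mem_left _ _ (X_mem_stairIdeal h),
        fun c k ρ κ hk hκ => ?_⟩
      rw [Submodule.mem_comap, LinearMap.mulLeft_apply]
      by_cases hkc : β c < k
      · exact Ideal.mul_mem_left _ _ (minor_mem_stairIdeal ρ κ c hkc hκ)
      have hcj : c < j := by
        by_contra hcj
        simp only [τ, if_neg hcj] at hk
        exact hkc hk
      simp only [τ, if_pos hcj] at hk
      have hκj : ∀ b, κ b < j := fun b => (hκ b).trans_lt hcj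
      have hmem := minor_mem_stairIdeal (K := K) (β := β) (r := r) (j := j)
        (Fin.cons r ρ : Fin (k + 1) → Fin n) (Fin.cons j κ) j (by omega)
        (Fin.cases le_rfl fun b => (hκj b).le)
      rw [Matrix.det_succ_row_zero, Fin.sum_univ_succ] at hmem
      have hrow : ∀ b : Fin k, (genMat K n).submatrix (Fin.cons r ρ : Fin (k + 1) → Fin n)
          (Fin.cons j κ : Fin (k + 1) → Fin n) 0 b.succ ∈ stairIdeal K β r j :=
        fun b => X_mem_stairIdeal (Or.inr ⟨rfl, hκj b⟩)
      rw [Submodule.add_mem_iff_left _ (Ideal.sum_mem _ fun b _ => Ideal.mul_mem_right _ _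
        (Ideal.mul_mem_left _ _ (hrow b)))] at hmem
      simpa [genMat, Matrix.submatrix, Function.comp_def] using hmem
    · have := stairIdeal_sup_span_X (K := K) (β := β) r.2 j.2
      rw [this]
      exact ih β hβ

theorem idealOfVars_eq_ker_constantCoeff (σ R : Type*) [CommRing R] :
    idealOfVars σ R = RingHom.ker (constantCoeff (σ := σ) (R := R)) := by
  ext f
  rw [← pow_one (idealOfVars σ R), mem_pow_idealOfVars_iff', RingHom.mem_ker, constantCoeff_eq]
  simp [Finsupp.degree_eq_zero_iff]

theorem stairIdeal_isRadical [Infinite K] (hβ : Monotone β) :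
    (stairIdeal K β 0 0).IsRadical := by
  suffices h : ∀ r, r ≤ n → ∀ τ : Fin n → ℕ, Monotone τ → (stairIdeal K τ r 0).IsRadical from
    h 0 (Nat.zero_le n) β hβ
  intro r hr
  induction hr using Nat.decreasingInduction with
  | self =>
    intro τ _
    rw [stairIdeal_eq_idealOfVars le_rfl, idealOfVars_eq_ker_constantCoeff]
    exact (RingHom.ker_isPrime _).isRadical
  | of_succ r hr ih =>
    suffices h : ∀ j, j ≤ n → ∀ τ : Fin n → ℕ, Monotone τ →
      (stairIdeal K τ r j).IsRadical from h 0 (Nat.zero_le n)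
    intro j hj
    induction hj using Nat.decreasingInduction with
    | self =>
      intro τ hτ
      rw [stairIdeal_row_end]
      exact ih τ hτ
    | of_succ j hj ih => exact fun τ hτ => stairIdeal_isRadical_of_succ hτ ⟨r, hr⟩ ⟨j, hj⟩ ih

end stairIdeal

section detIdeal

open MvPolynomial

variable {K : Type*} [Field K] {n t : ℕ}

theorem minor_mem_detIdeal_of_eq (ρ κ : Fin t → Fin n) :
    ((genMat K n).submatrix ρ κ).det ∈ detIdeal K n t := by
  by_cases hρ : Function.Injective ρ
  swap
  · obtain ⟨a, b, hab, hne⟩ := Function.not_injective_iff.1 hρ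
    rw [Matrix.det_zero_of_row_eq hne (by ext; simp [hab])]
    exact zero_mem _
  by_cases hκ : Function.Injective κ
  swap
  · obtain ⟨a, b, hab, hne⟩ := Function.not_injective_iff.1 hκ
    rw [Matrix.det_zero_of_column_eq hne (by intro; simp [hab])]
    exact zero_mem _
  have key : ∀ f : Fin t → Fin n, Function.Injective f → ∃ (s : Finset (Fin n)) (hs : s.card = t)
      (σ : Equiv.Perm (Fin t)), ∀ a, f a = s.orderIsoOfFin hs (σ a) := by
    intro f hf
    have hs : (Finset.univ.image f).card = t := by
      rw [Finset.card_image_of_injective _ hf, Finset.card_univ, Fintype.card_fin]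
    have hmem : ∀ a, f a ∈ Finset.univ.image f := fun a =>
      Finset.mem_image_of_mem _ (Finset.mem_univ a)
    refine ⟨Finset.univ.image f, hs, Equiv.ofBijective
      (fun a => ((Finset.univ.image f).orderIsoOfFin hs).symm ⟨f a, hmem a⟩)
      (Finite.injective_iff_bijective.1 fun a b hab => hf ?_), fun a => ?_⟩
    · simpa using hab
    · simp
  obtain ⟨I, hI, σ, hσ⟩ := key ρ hρ
  obtain ⟨J, hJ, σ', hσ'⟩ := key κ hκ
  have heq : (genMat K n).submatrix ρ κ = ((Matrix.of fun a b : Fin t =>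
      genMat K n (I.orderIsoOfFin hI a) (J.orderIsoOfFin hJ b)).submatrix σ id).submatrix
        id σ' := by
    ext a b
    simp [hσ, hσ']
  rw [heq, Matrix.det_permute', Matrix.det_permute]
  exact Ideal.mul_mem_left _ _ (Ideal.mul_mem_left _ _ (Ideal.subset_span ⟨I, J, hI, hJ, rfl⟩))

theorem minor_mem_detIdeal {k : ℕ} (hk : t ≤ k) (ρ κ : Fin k → Fin n) :
    ((genMat K n).submatrix ρ κ).det ∈ detIdeal K n t := by
  induction k, hk using Nat.le_induction with
  | base => exact minor_mem_detIdeal_of_eq ρ κ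
  | succ k hk ih =>
    rw [Matrix.det_succ_row_zero]
    refine Ideal.sum_mem _ fun b _ => Ideal.mul_mem_left _ _ ?_
    rw [Matrix.submatrix_submatrix]
    exact ih _ _

theorem detIdeal_le_iff {I : Ideal (MvPolynomial (Fin n × Fin n) K)} :
    detIdeal K n t ≤ I ↔
      ∀ ρ κ : Fin t → Fin n, ((genMat K n).submatrix ρ κ).det ∈ I := by
  refine ⟨fun h ρ κ => h (minor_mem_detIdeal_of_eq ρ κ), fun h => Ideal.span_le.2 ?_⟩
  rintro _ ⟨I, J, hI, hJ, rfl⟩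
  exact h (fun a => I.orderIsoOfFin hI a) (fun b => J.orderIsoOfFin hJ b)

theorem detIdeal_succ_eq_stairIdeal (hn : 0 < n) :
    detIdeal K n (t + 1) = stairIdeal K (fun _ : Fin n => t) 0 0 := by
  apply le_antisymm
  · exact detIdeal_le_iff.2 fun ρ κ => minor_mem_stairIdeal ρ κ ⟨n - 1, by omega⟩
      (Nat.lt_succ_self t) fun b => Fin.le_def.2 (by simp; omega)
  · exact stairIdeal_le_iff.2 ⟨fun i c h => by omega, fun c k ρ κ hk _ => minor_mem_detIdeal hk ρ κ⟩

theorem detIdeal_succ_isRadical [Infinite K] (hn : 0 < n) : (detIdeal K n (t + 1)).IsRadical := by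
  rw [detIdeal_succ_eq_stairIdeal hn]
  exact stairIdeal_isRadical monotone_const

theorem finrank_span_range_col_le_iff {L m l : Type*} [Field L] [Finite m] [Finite l]
    (M : Matrix m l L) (d : ℕ) :
    Module.finrank L (Submodule.span L (Set.range M.col)) ≤ d ↔
      ∀ (ρ : Fin (d + 1) → m) (κ : Fin (d + 1) → l), (M.submatrix ρ κ).det = 0 := by
  rw [← Set.image_univ, finrank_span_col_le_iff]
  refine ⟨fun h ρ κ => h _ (Nat.lt_succ_self d) ρ κ fun _ => Set.mem_univ _, fun h k hk => ?_⟩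
  induction k, Nat.succ_le_of_lt hk using Nat.le_induction with
  | base => exact fun ρ κ _ => h ρ κ
  | succ k hdk ih =>
    intro ρ κ _
    rw [Matrix.det_succ_row_zero]
    refine Finset.sum_eq_zero fun b _ => ?_
    rw [Matrix.submatrix_submatrix, ih (Nat.lt_of_succ_le hdk) _ _ fun _ => Set.mem_univ _,
      mul_zero]

/-- The `L`-points of the determinantal variety. -/
theorem detIdeal_succ_le_ker_iff {L : Type*} [Field L]
    (φ : MvPolynomial (Fin n × Fin n) K →+* L) :
    detIdeal K n (t + 1) ≤ RingHom.ker φ ↔ Module.finrank L (Submodule.span L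
      (Set.range (Matrix.of fun i c => φ (X (i, c))).col)) ≤ t := by
  simp only [detIdeal_le_iff, finrank_span_range_col_le_iff, RingHom.mem_ker,
    map_det_submatrix_genMat]

/-- The comorphism of the multiplication of an `n × t` and a `t × n` matrix. -/
noncomputable def mulHom (K : Type*) [Field K] (n t : ℕ) :
    MvPolynomial (Fin n × Fin n) K →+* MvPolynomial ((Fin n × Fin t) ⊕ (Fin t × Fin n)) K :=
  eval₂Hom C fun p => ∑ l, X (Sum.inl (p.1, l)) * X (Sum.inr (l, p.2))

theorem exists_eq_mul_of_finrank_le {L : Type*} [Field L] (M : Matrix (Fin n) (Fin n) L)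
    (h : Module.finrank L (Submodule.span L (Set.range M.col)) ≤ t) :
    ∃ (A : Matrix (Fin n) (Fin t) L) (B : Matrix (Fin t) (Fin n) L), M = A * B := by
  set W := Submodule.span L (Set.range M.col)
  obtain ⟨g, hg⟩ : ∃ g : (Fin t → L) →ₗ[L] W, Function.Surjective g :=
    ⟨(Module.finBasis L W).equivFun.symm.toLinearMap ∘ₗ LinearMap.funLeft L L (Fin.castLE h),
      (Module.finBasis L W).equivFun.symm.surjective.comp
        (LinearMap.funLeft_surjective_of_injective _ _ _ (Fin.castLE_injective h))⟩
  choose b hb using fun c => hg ⟨M.col c, Submodule.subset_span ⟨c, rfl⟩⟩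
  refine ⟨LinearMap.toMatrix' (W.subtype ∘ₗ g), Matrix.of fun l c => b c l, ?_⟩
  ext i c
  have h1 := congrArg (fun w : W => (w : Fin n → L) i) (hb c)
  have h2 : (W.subtype ∘ₗ g) (b c) = (LinearMap.toMatrix' (W.subtype ∘ₗ g)).mulVec (b c) :=
    (LinearMap.toMatrix'_mulVec _ _).symm
  calc M i c = (W.subtype ∘ₗ g) (b c) i := h1.symm
    _ = _ := by rw [h2]; rfl

theorem detIdeal_succ_eq_ker_mulHom [Infinite K] (hn : 0 < n) :
    detIdeal K n (t + 1) = RingHom.ker (mulHom K n t) := by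
  apply le_antisymm
  · let ι := algebraMap (MvPolynomial ((Fin n × Fin t) ⊕ (Fin t × Fin n)) K)
      (FractionRing (MvPolynomial ((Fin n × Fin t) ⊕ (Fin t × Fin n)) K))
    have hι : RingHom.ker (ι.comp (mulHom K n t)) = RingHom.ker (mulHom K n t) := by
      ext x
      simp [RingHom.mem_ker, ι]
    rw [← hι, detIdeal_succ_le_ker_iff]
    let A := Matrix.of fun (i : Fin n) (l : Fin t) => ι (X (Sum.inl (i, l)))
    let B := Matrix.of fun (l : Fin t) (c : Fin n) => ι (X (Sum.inr (l, c)))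
    have hAB : (Matrix.of fun i c => (ι.comp (mulHom K n t)) (X (i, c))) = A * B := by
      ext i c
      simp [mulHom, Matrix.mul_apply, A, B]
    rw [hAB, ← Matrix.rank_eq_finrank_span_cols]
    exact (Matrix.rank_mul_le_left A B).trans (Matrix.rank_le_width A)
  · intro f hf
    rw [← (detIdeal_succ_isRadical hn).radical, Ideal.radical_eq_sInf, Submodule.mem_sInf]
    rintro p ⟨hp, hprime⟩
    set φ := (algebraMap (_ ⧸ p) (FractionRing (_ ⧸ p))).comp (Ideal.Quotient.mk p) with hφ
    have hker : RingHom.ker φ = p := exists_field_ker_eq p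
    rw [← hker, detIdeal_succ_le_ker_iff] at hp
    obtain ⟨A, B, hAB⟩ := exists_eq_mul_of_finrank_le _ hp
    have hcomp : (eval₂Hom (φ.comp C) (Sum.elim (fun q => A q.1 q.2) fun q => B q.1 q.2)).comp
        (mulHom K n t) = φ := by
      refine MvPolynomial.ringHom_ext (fun a => by simp [mulHom]) fun ⟨i, c⟩ => ?_
      have := congrFun (congrFun hAB i) c
      rw [Matrix.mul_apply] at this
      simp [mulHom, ← this]
    rw [← hker, RingHom.mem_ker, ← hcomp, RingHom.comp_apply, RingHom.mem_ker.1 hf, map_zero]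

theorem detIdeal_succ_isPrime [Infinite K] (hn : 0 < n) : (detIdeal K n (t + 1)).IsPrime := by
  rw [detIdeal_succ_eq_ker_mulHom hn]
  exact RingHom.ker_isPrime _

end detIdeal

section Qideal

open MvPolynomial

variable {K : Type*} [Field K] {n : ℕ}

theorem prinMinorIdeal_eq_span_adjugate (m : ℕ) :
    prinMinorIdeal K (m + 1) m =
      Ideal.span (Set.range fun k => (genMat K (m + 1)).adjugate k k) := by
  have key : ∀ k : Fin (m + 1), (genMat K (m + 1)).adjugate k k =
      ((genMat K (m + 1)).submatrix (fun i : {x // x ∈ Finset.univ.erase k} => (i : Fin (m + 1)))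
        (fun j : {x // x ∈ Finset.univ.erase k} => (j : Fin (m + 1)))).det := by
    intro k
    let e : Fin m ≃ {x // x ∈ Finset.univ.erase k} :=
      (finSuccAboveEquiv k).trans (Equiv.subtypeEquivRight (by simp))
    rw [Matrix.adjugate_fin_succ_eq_det_submatrix, ← Matrix.det_submatrix_equiv_self e,
      Matrix.submatrix_submatrix, Even.neg_one_pow ⟨(k : ℕ), rfl⟩, one_mul]
    rfl
  unfold prinMinorIdeal
  congr 1
  ext p
  constructor
  · rintro ⟨s, hs, rfl⟩
    obtain ⟨k, hk⟩ : ∃ k, sᶜ = {k} := by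
      rw [← Finset.card_eq_one, Finset.card_compl, hs, Fintype.card_fin]
      omega
    obtain rfl : s = Finset.univ.erase k := by
      rw [← compl_compl s, hk]
      ext
      simp
    exact ⟨k, key k⟩
  · rintro ⟨k, rfl⟩
    exact ⟨Finset.univ.erase k, by simp, key k⟩

theorem prinMinorIdeal_sub_one_le_ker_iff {R : Type*} [CommRing R] (hn : 0 < n)
    (φ : MvPolynomial (Fin n × Fin n) K →+* R) :
    prinMinorIdeal K n (n - 1) ≤ RingHom.ker φ ↔
      ∀ k, (φ.mapMatrix (genMat K n)).adjugate k k = 0 := by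
  obtain ⟨m, rfl⟩ := Nat.exists_eq_succ_of_ne_zero hn.ne'
  rw [Nat.succ_sub_one, prinMinorIdeal_eq_span_adjugate, Ideal.span_le, Set.range_subset_iff,
    ← RingHom.map_adjugate]
  rfl

theorem mem_Qideal_iff {f : MvPolynomial (Fin n × Fin n) K} :
    f ∈ Qideal K n ↔ ∃ k : ℕ, (genMat K n).det ^ k * f ∈ prinMinorIdeal K n (n - 1) := by
  rw [Qideal, Ideal.mem_comap, IsLocalization.algebraMap_mem_map_algebraMap_iff
    (Submonoid.powers (genMat K n).det)]
  simp [Submonoid.mem_powers_iff]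

theorem prinMinorIdeal_le_Qideal : prinMinorIdeal K n (n - 1) ≤ Qideal K n :=
  Ideal.le_comap_map

theorem Qideal_le_ker {R : Type*} [CommRing R] [IsDomain R] (hn : 0 < n)
    (φ : MvPolynomial (Fin n × Fin n) K →+* R)
    (hadj : ∀ k, (φ.mapMatrix (genMat K n)).adjugate k k = 0)
    (hdet : (φ.mapMatrix (genMat K n)).det ≠ 0) : Qideal K n ≤ RingHom.ker φ := by
  intro f hf
  obtain ⟨k, hk⟩ := mem_Qideal_iff.1 hf
  have h := (prinMinorIdeal_sub_one_le_ker_iff hn φ).2 hadj hk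
  rw [RingHom.mem_ker, map_mul, map_pow, RingHom.map_det] at h
  exact (mul_eq_zero.1 h).resolve_left (pow_ne_zero k hdet)

/-- The generic matrix with zero diagonal. -/
noncomputable def hollowMat (K : Type*) [Field K] (n : ℕ) :
    Matrix (Fin n) (Fin n) (MvPolynomial (Fin n × Fin n) K) :=
  Matrix.of fun i j => if i = j then 0 else X (i, j)

theorem det_hollowMat_ne_zero (hn : 2 ≤ n) : (hollowMat K n).det ≠ 0 := by
  intro h
  let e : MvPolynomial (Fin n × Fin n) K →+* K :=
    eval fun p => (finRotate n).permMatrix K p.1 p.2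
  have hmap : e.mapMatrix (hollowMat K n) = (finRotate n).permMatrix K := by
    ext i j
    by_cases hij : i = j
    · have : finRotate n i ≠ i := by
        rw [← Equiv.Perm.mem_support, support_finRotate_of_le hn]
        exact Finset.mem_univ i
      subst hij
      simp [hollowMat, Equiv.Perm.permMatrix, PEquiv.toMatrix_apply, -finRotate_apply, this]
    · simp [hollowMat, hij, e]
  have hd := congrArg e h
  rw [map_zero, RingHom.map_det, hmap, Matrix.det_permutation] at hd
  rcases Int.units_eq_one_or (Equiv.Perm.sign (finRotate n)) with hs | hs <;> simp [hs] at hd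

/-- The ring of functions on the invertible matrices with zero diagonal. -/
abbrev HollowRing (K : Type*) [Field K] (n : ℕ) : Type _ :=
  Localization.Away (hollowMat K n).det

/-- The generic matrix with zero diagonal, made invertible. -/
noncomputable def unitHollowMat (K : Type*) [Field K] (n : ℕ) :
    Matrix (Fin n) (Fin n) (HollowRing K n) :=
  (algebraMap _ (HollowRing K n)).mapMatrix (hollowMat K n)

theorem unitHollowMat_diag (k : Fin n) : unitHollowMat K n k k = 0 := by
  simp [unitHollowMat, hollowMat]

theorem isUnit_det_unitHollowMat : IsUnit (unitHollowMat K n).det := by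
  rw [unitHollowMat, ← RingHom.map_det]
  exact IsLocalization.Away.algebraMap_isUnit _

theorem isDomain_hollowRing (hn : 2 ≤ n) : IsDomain (HollowRing K n) :=
  IsLocalization.isDomain_localization
    (powers_le_nonZeroDivisors_of_noZeroDivisors (det_hollowMat_ne_zero hn))

/-- The comorphism of the inversion of invertible matrices with zero diagonal. -/
noncomputable def invHom (K : Type*) [Field K] (n : ℕ) :
    MvPolynomial (Fin n × Fin n) K →+* HollowRing K n :=
  eval₂Hom ((algebraMap (MvPolynomial (Fin n × Fin n) K) (HollowRing K n)).comp C)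
    fun p => (unitHollowMat K n)⁻¹ p.1 p.2

theorem invHom_mapMatrix_genMat : (invHom K n).mapMatrix (genMat K n) = (unitHollowMat K n)⁻¹ := by
  ext i j
  simp [invHom, genMat]

theorem unitHollowMat_mul_mapMatrix_genMat :
    unitHollowMat K n * (invHom K n).mapMatrix (genMat K n) = 1 := by
  rw [invHom_mapMatrix_genMat, Matrix.mul_nonsing_inv _ isUnit_det_unitHollowMat]

theorem invHom_det_ne_zero (hn : 2 ≤ n) : ((invHom K n).mapMatrix (genMat K n)).det ≠ 0 := by
  have := isDomain_hollowRing (K := K) hn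
  have h := congrArg Matrix.det (unitHollowMat_mul_mapMatrix_genMat (K := K) (n := n))
  rw [Matrix.det_mul, Matrix.det_one] at h
  exact right_ne_zero_of_mul_eq_one h

theorem adjugate_eq_smul_of_mul_eq_one {R : Type*} [CommRing R] {m : Type*} [Fintype m]
    [DecidableEq m] {A B : Matrix m m R} (h : A * B = 1) : B.adjugate = B.det • A := by
  calc B.adjugate = A * B * B.adjugate := by rw [h, one_mul]
    _ = B.det • A := by rw [mul_assoc, Matrix.mul_adjugate, Matrix.mul_smul, mul_one]

theorem exists_comp_invHom_eq {R : Type*} [CommRing R] (π : MvPolynomial (Fin n × Fin n) K →+* R)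
    (hadj : ∀ k, (π.mapMatrix (genMat K n)).adjugate k k = 0)
    (hdet : IsUnit (π.mapMatrix (genMat K n)).det) :
    ∃ θ : HollowRing K n →+* R, θ.comp (invHom K n) = π := by
  set M := π.mapMatrix (genMat K n) with hM
  let ψ : MvPolynomial (Fin n × Fin n) K →+* R := eval₂Hom (π.comp C) fun p => M⁻¹ p.1 p.2
  have hψ : ψ.mapMatrix (hollowMat K n) = M⁻¹ := by
    ext i j
    by_cases hij : i = j
    · subst hij
      simp [hollowMat, Matrix.inv_def, hadj]
    · simp [hollowMat, hij, ψ]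
  have hunit : IsUnit (ψ (hollowMat K n).det) := by
    rw [RingHom.map_det, hψ]
    exact Matrix.isUnit_nonsing_inv_det_iff.2 hdet
  let θ : HollowRing K n →+* R := IsLocalization.Away.lift (hollowMat K n).det hunit
  have hθ : ∀ a, θ (algebraMap _ _ a) = ψ a := IsLocalization.Away.lift_eq _ hunit
  have hθU : θ.mapMatrix (unitHollowMat K n) = M⁻¹ := by
    rw [← hψ]
    ext i j
    simp only [unitHollowMat, RingHom.mapMatrix_apply, Matrix.map_apply, hθ]
  have hθM : θ.mapMatrix ((unitHollowMat K n)⁻¹) = M := by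
    have h := congrArg θ.mapMatrix
      (Matrix.mul_nonsing_inv _ (isUnit_det_unitHollowMat (K := K) (n := n)))
    rw [map_mul, hθU, map_one] at h
    rw [← Matrix.inv_eq_right_inv h, Matrix.nonsing_inv_nonsing_inv _ hdet]
  refine ⟨θ, MvPolynomial.ringHom_ext (fun a => ?_) fun ⟨i, j⟩ => ?_⟩
  · simp [invHom, hθ, ψ]
  · simpa [invHom, hM, genMat] using congrFun (congrFun hθM i) j

theorem Qideal_eq_ker_invHom (hn : 2 ≤ n) : Qideal K n = RingHom.ker (invHom K n) := by
  have := isDomain_hollowRing (K := K) hn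
  apply le_antisymm
  · refine Qideal_le_ker (by omega) _ (fun k => ?_) (invHom_det_ne_zero hn)
    rw [adjugate_eq_smul_of_mul_eq_one unitHollowMat_mul_mapMatrix_genMat, Matrix.smul_apply,
      unitHollowMat_diag, smul_zero]
  · intro f hf
    let J := Ideal.map (algebraMap (MvPolynomial (Fin n × Fin n) K)
      (Localization.Away (genMat K n).det)) (prinMinorIdeal K n (n - 1))
    let π : MvPolynomial (Fin n × Fin n) K →+* Localization.Away (genMat K n).det ⧸ J :=
      (Ideal.Quotient.mk J).comp (algebraMap _ _)
    have hker : RingHom.ker π = Qideal K n := by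
      rw [← RingHom.comap_ker, Ideal.mk_ker]
      rfl
    obtain ⟨θ, hθ⟩ := exists_comp_invHom_eq π
      ((prinMinorIdeal_sub_one_le_ker_iff (by omega) π).1 (hker ▸ prinMinorIdeal_le_Qideal)) (by
        rw [← RingHom.map_det]
        exact (IsLocalization.Away.algebraMap_isUnit (genMat K n).det).map (Ideal.Quotient.mk J))
    rw [← hker, RingHom.mem_ker, ← hθ, RingHom.comp_apply, RingHom.mem_ker.1 hf, map_zero]

theorem Qideal_isPrime (hn : 2 ≤ n) : (Qideal K n).IsPrime := by
  have := isDomain_hollowRing (K := K) hn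
  rw [Qideal_eq_ker_invHom hn]
  exact RingHom.ker_isPrime _

end Qideal

section Deformation

open Polynomial

theorem deformed_inverse_mul {R m : Type*} [CommRing R] [Fintype m] [DecidableEq m]
    {N A : Matrix m m R} {u v δ ε p q : m → R} (T : R) (hNp : N *ᵥ p = 0) (hvA : v ᵥ* A = 0)
    (hNA : N * A = 1 - vecMulVec u q) (hvp : v ⬝ᵥ p = 1) (hεp : ε ⬝ᵥ p = 0) (hqδ : q ⬝ᵥ δ = 0) :
    (T • N + vecMulVec (u + δ) (v + ε)) *
      ((1 - vecMulVec p ε) * (A + T • vecMulVec p q) * (1 - vecMulVec δ q)) = T • 1 := by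
  have h1 : (T • N + vecMulVec (u + δ) (v + ε)) * (1 - vecMulVec p ε) =
      T • N + vecMulVec (u + δ) v := by
    rw [mul_sub, mul_one, add_mul, Matrix.smul_mul, mul_vecMulVec, hNp, zero_vecMulVec, smul_zero,
      zero_add, vecMulVec_mul_vecMulVec, add_dotProduct, hvp, hεp, add_zero, one_smul,
      vecMulVec_add]
    abel
  have h2 : (T • N + vecMulVec (u + δ) v) * (A + T • vecMulVec p q) =
      T • (1 + vecMulVec δ q) := by
    rw [mul_add, add_mul, add_mul, Matrix.smul_mul, hNA, vecMulVec_mul, hvA, vecMulVec_zero,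
      Matrix.mul_smul, Matrix.mul_smul, Matrix.smul_mul, mul_vecMulVec, hNp, zero_vecMulVec,
      vecMulVec_mul_vecMulVec, hvp, one_smul, add_vecMulVec]
    simp only [smul_sub, smul_add, smul_zero]
    abel
  rw [← mul_assoc, ← mul_assoc, h1, h2, Matrix.smul_mul, mul_sub, mul_one, add_mul, one_mul,
    vecMulVec_mul_vecMulVec, hqδ, zero_smul, vecMulVec_zero]
  abel_nf

theorem exists_polynomial_factor {L : Type*} [Field L] {a b : L} (c : L) (hab : a * b = 0) :
    ∃ d e : L[X], d.eval 0 = 0 ∧ e.eval 0 = 0 ∧ (a ≠ 0 → d = 0) ∧ (b ≠ 0 → e = 0) ∧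
      X ^ 2 * C c + (C a + d) * (C b + e) = 0 := by
  by_cases ha : a = 0
  · subst ha
    by_cases hb : b = 0
    · subst hb
      refine ⟨X, -X * C c, by simp, by simp, by simp, by simp, ?_⟩
      rw [C_0]
      ring
    · refine ⟨-X ^ 2 * C (c * b⁻¹), 0, by simp, by simp, by simp, by simp, ?_⟩
      have h : C (c * b⁻¹) * C b = C c := by rw [← C_mul, inv_mul_cancel_right₀ hb]
      rw [C_0, ← h]
      ring
  · obtain rfl : b = 0 := (mul_eq_zero.1 hab).resolve_left ha
    refine ⟨0, -X ^ 2 * C (c * a⁻¹), by simp, by simp, by simp, by simp, ?_⟩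
    have h : C (c * a⁻¹) * C a = C c := by rw [← C_mul, inv_mul_cancel_right₀ ha]
    rw [C_0, ← h]
    ring

theorem det_add_vecMulVec_single {R m : Type*} [CommRing R] [Fintype m] [DecidableEq m]
    (A : Matrix m m R) (i j : m) :
    (A + vecMulVec (Pi.single i 1) (Pi.single j 1)).det = A.det + A.adjugate j i := by
  rw [adjugate_apply, ← Matrix.updateRow_eq_self A i, Matrix.updateRow_idem]
  have h : A.updateRow i (A i) + vecMulVec (Pi.single i 1) (Pi.single j 1) =
      A.updateRow i (A i + Pi.single j 1) := by
    ext k l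
    by_cases hk : k = i
    · subst hk
      simp [vecMulVec_apply]
    · simp [vecMulVec_apply, hk]
  rw [h, Matrix.det_updateRow_add]

/-- A corank one matrix all of whose principal cofactors vanish is a limit of
invertible matrices whose inverse has zero diagonal. -/
theorem exists_deformation_of_adjugate_ne_zero {L m : Type*} [Field L] [Fintype m] [DecidableEq m]
    {A : Matrix m m L} (hdet : A.det = 0) (hdiag : ∀ k, A.adjugate k k = 0)
    (hne : A.adjugate ≠ 0) :
    ∃ B : Matrix m m L[X], (evalRingHom 0).mapMatrix B = A ∧ B.det ≠ 0 ∧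
      ∀ k, B.adjugate k k = 0 := by
  obtain ⟨j, i, ha⟩ : ∃ j i, A.adjugate j i ≠ 0 := by
    by_contra! h
    exact hne (Matrix.ext h)
  set a := A.adjugate j i
  let u : m → L := fun k => A.adjugate k i / a
  let v : m → L := fun k => A.adjugate j k / a
  let p : m → L := Pi.single i 1
  let q : m → L := Pi.single j 1
  let G := A + vecMulVec p q
  have hu : u j = 1 := div_self ha
  have hv : v i = 1 := div_self ha
  have hAu : A *ᵥ u = 0 := by
    ext k
    have h := congrFun (congrFun (A.mul_adjugate) k) i
    rw [hdet, zero_smul, Matrix.mul_apply] at h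
    simp only [mulVec, dotProduct, u, mul_div_assoc', ← Finset.sum_div, h]
    simp
  have hvA : v ᵥ* A = 0 := by
    ext k
    have h := congrFun (congrFun (A.adjugate_mul) j) k
    rw [hdet, zero_smul, Matrix.mul_apply] at h
    simp only [vecMul, dotProduct, v, div_mul_eq_mul_div, ← Finset.sum_div, h]
    simp
  have hG : IsUnit G.det := by
    rw [isUnit_iff_ne_zero, det_add_vecMulVec_single, hdet, zero_add]
    exact ha
  have hGp : G⁻¹ *ᵥ p = u := by
    have h : G *ᵥ u = p := by
      rw [Matrix.add_mulVec, hAu, zero_add, vecMulVec_mulVec]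
      simp [q, hu]
    rw [← h, mulVec_mulVec, nonsing_inv_mul _ hG, one_mulVec]
  let N := G⁻¹ - vecMulVec u v
  have hNp : N *ᵥ p = 0 := by
    rw [Matrix.sub_mulVec, hGp, vecMulVec_mulVec]
    simp [p, hv]
  have hNA : N * A = 1 - vecMulVec u q := by
    have h : A = G - vecMulVec p q := by simp [G]
    rw [sub_mul, vecMulVec_mul, hvA, vecMulVec_zero, sub_zero, h, mul_sub, nonsing_inv_mul _ hG,
      mul_vecMulVec, hGp]
  have huv : ∀ k, u k * v k = 0 := by
    intro k
    have h := congrArg (N * ·) A.mul_adjugate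
    simp only [hdet, zero_smul, mul_zero, ← mul_assoc, hNA, sub_mul, one_mul, vecMulVec_mul,
      sub_eq_zero] at h
    have h1 := congrFun (congrFun h k) k
    simp only [hdiag, vecMulVec_apply, q, single_one_vecMul] at h1
    have h2 : u k * A.adjugate j k = 0 := h1.symm
    rw [mul_div_assoc', h2, zero_div]
  choose δ ε hδ hε hδu hεv hZ using fun k => exists_polynomial_factor (N k k) (huv k)
  let c : L →+* L[X] := C
  let B : Matrix m m L[X] := (1 - vecMulVec (c ∘ p) ε) *
    (c.mapMatrix A + (X ^ 2 : L[X]) • vecMulVec (c ∘ p) (c ∘ q)) * (1 - vecMulVec δ (c ∘ q))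
  have hZB := deformed_inverse_mul (N := c.mapMatrix N) (A := c.mapMatrix A) (u := c ∘ u)
    (v := c ∘ v) (δ := δ) (ε := ε) (p := c ∘ p) (q := c ∘ q) (X ^ 2)
    (by ext k; simp [← RingHom.map_mulVec, hNp])
    (by ext k; simp [← RingHom.map_vecMul, hvA])
    (by
      rw [← map_mul, hNA]
      ext k l : 2
      simp [vecMulVec_apply, Matrix.one_apply, apply_ite c])
    (by simp [← RingHom.map_dotProduct, p, hv])
    (by simp [p, Pi.single_apply, dotProduct, hεv i (by simp [hv])])
    (by simp [q, Pi.single_apply, dotProduct, hδu j (by simp [hu])])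
  set Z := (X ^ 2 : L[X]) • c.mapMatrix N + vecMulVec (c ∘ u + δ) (c ∘ v + ε)
  change Z * B = _ at hZB
  have hX : (X ^ 2 : L[X]) ≠ 0 := pow_ne_zero 2 X_ne_zero
  refine ⟨B, ?_, ?_, fun k => ?_⟩
  · have h1 : (evalRingHom 0).mapMatrix (vecMulVec (c ∘ p) ε) = 0 := by
      ext k l
      simp [vecMulVec_apply, hε]
    have h2 : (evalRingHom 0).mapMatrix (vecMulVec δ (c ∘ q)) = 0 := by
      ext k l
      simp [vecMulVec_apply, hδ]
    have h3 : (evalRingHom 0).mapMatrix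
        (c.mapMatrix A + (X ^ 2 : L[X]) • vecMulVec (c ∘ p) (c ∘ q)) = A := by
      ext k l
      simp [c]
    rw [map_mul, map_mul, map_sub, map_sub, h1, h2, h3]
    simp
  · intro h
    have := congrArg Matrix.det hZB
    rw [Matrix.det_mul, h, mul_zero, Matrix.det_smul, Matrix.det_one, mul_one] at this
    exact pow_ne_zero _ hX this.symm
  · have h := congrArg (· * B.adjugate) hZB
    simp only [mul_assoc, Matrix.mul_adjugate, Matrix.mul_smul, mul_one, Matrix.smul_mul,
      one_mul] at h
    have h1 := congrFun (congrFun h k) k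
    have hZk : Z k k = 0 := by
      rw [← hZ k]
      simp [Z, c, vecMulVec_apply]
    simp only [Matrix.smul_apply, hZk, smul_eq_mul, mul_zero] at h1
    exact (mul_eq_zero.1 h1.symm).resolve_left hX

end Deformation

section SecondaryMinor

variable {R m : Type*} [CommRing R] [Fintype m] [DecidableEq m]

/-- The signed minor of `A` obtained by deleting the rows `p`, `q` and the columns `r`, `s`. -/
def secondaryMinor (A : Matrix m m R) (p q r s : m) : R :=
  ((A.updateRow p (Pi.single r 1)).updateRow q (Pi.single s 1)).det

theorem map_secondaryMinor {S : Type*} [CommRing S] (φ : R →+* S) (A : Matrix m m R)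
    (p q r s : m) : φ (secondaryMinor A p q r s) = secondaryMinor (φ.mapMatrix A) p q r s := by
  have hsingle : ∀ k : m, φ ∘ Pi.single k (1 : R) = Pi.single k 1 := fun k => by
    ext l
    simp [Pi.single_apply, apply_ite φ]
  simp only [secondaryMinor, RingHom.map_det, RingHom.mapMatrix_apply, Matrix.map_updateRow,
    hsingle]

theorem det_updateRow_updateRow_one {p q : m} (hpq : p ≠ q) (x y : m → R) :
    (((1 : Matrix m m R).updateRow p x).updateRow q y).det = x p * y q - x q * y p := by
  let U : Matrix m (Fin 2) R := Matrix.of fun i => ![(1 : Matrix m m R) i p, (1 : Matrix m m R) i q]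
  let V : Matrix (Fin 2) m R := Matrix.of ![x - Pi.single p 1, y - Pi.single q 1]
  have h : ((1 : Matrix m m R).updateRow p x).updateRow q y = 1 + U * V := by
    ext i j
    rw [Matrix.add_apply, Matrix.mul_apply, Fin.sum_univ_two]
    by_cases hq : i = q
    · subst hq
      simp [U, V, Matrix.one_apply, hpq.symm, Pi.single_apply, @eq_comm _ j]
    · by_cases hp : i = p
      · subst hp
        simp [U, V, Matrix.one_apply, hq, Pi.single_apply, @eq_comm _ j]
      · simp [U, V, Matrix.one_apply, hp, hq]
  rw [h, Matrix.det_one_add_mul_comm, Matrix.det_fin_two]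
  have hV : ∀ k, (V * U) k 0 = V k p ∧ (V * U) k 1 = V k q := fun k => by
    simp [U, Matrix.mul_apply, Matrix.one_apply]
  simp only [Matrix.add_apply, hV]
  simp [V, hpq, hpq.symm]

theorem secondaryMinor_mul_det {A Y : Matrix m m R} (h : A * Y = 1) {p q : m} (hpq : p ≠ q)
    (r s : m) : secondaryMinor A p q r s * Y.det = Y r p * Y s q - Y r q * Y s p := by
  rw [secondaryMinor, ← Matrix.det_mul, Matrix.updateRow_mul, Matrix.updateRow_mul, h,
    Matrix.single_one_vecMul, Matrix.single_one_vecMul]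
  exact det_updateRow_updateRow_one hpq _ _

theorem secondaryMinor_ne_zero [IsDomain R] {A : Matrix m m R} {p q r s : m} (hpq : p ≠ q)
    (h : ∀ w : m → R, w r = 0 → w s = 0 → (∀ i, i ≠ p → i ≠ q → (A *ᵥ w) i = 0) → w = 0) :
    secondaryMinor A p q r s ≠ 0 := by
  intro h0
  obtain ⟨w, hw, hAw⟩ := Matrix.exists_mulVec_eq_zero_iff.2 h0
  refine hw (h w ?_ ?_ fun i hp hq => ?_)
  · simpa [mulVec, Matrix.updateRow_apply, hpq] using congrFun hAw p
  · simpa [mulVec, Matrix.updateRow_apply] using congrFun hAw q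
  · simpa [mulVec, Matrix.updateRow_apply, hp, hq] using congrFun hAw i

/-- A relation between the secondary minors of a matrix whose inverse has zero diagonal. -/
def hollowRelation (A : Matrix m m R) (e : Fin 4 → m) : R :=
  secondaryMinor A (e 2) (e 3) (e 0) (e 2) * secondaryMinor A (e 0) (e 1) (e 1) (e 3) -
    secondaryMinor A (e 3) (e 1) (e 2) (e 3) * secondaryMinor A (e 2) (e 0) (e 0) (e 1)

theorem hollowRelation_eq_zero {A Y : Matrix m m R} (h : A * Y = 1) (hY : ∀ k, Y k k = 0)
    (e : Fin 4 ↪ m) : hollowRelation A e = 0 := by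
  have hdet : IsUnit (Y.det ^ 2) := by
    refine IsUnit.pow 2 (IsUnit.of_mul_eq_one A.det ?_)
    rw [mul_comm, ← Matrix.det_mul, h, Matrix.det_one]
  have hm : ∀ {p q : Fin 4}, p ≠ q → ∀ r s, secondaryMinor A (e p) (e q) (e r) (e s) * Y.det =
      Y (e r) (e p) * Y (e s) (e q) - Y (e r) (e q) * Y (e s) (e p) :=
    fun hpq _ _ => secondaryMinor_mul_det h (e.injective.ne hpq) _ _
  have h1 := hm (show (2 : Fin 4) ≠ 3 by decide) 0 2
  have h2 := hm (show (0 : Fin 4) ≠ 1 by decide) 1 3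
  have h3 := hm (show (3 : Fin 4) ≠ 1 by decide) 2 3
  have h4 := hm (show (2 : Fin 4) ≠ 0 by decide) 0 1
  simp only [hY] at h1 h2 h3 h4
  refine hdet.mul_left_eq_zero.1 ?_
  unfold hollowRelation
  linear_combination (secondaryMinor A (e 0) (e 1) (e 1) (e 3) * Y.det) * h1 +
    (Y (e 0) (e 2) * Y (e 2) (e 3)) * h2 -
    (secondaryMinor A (e 2) (e 0) (e 0) (e 1) * Y.det) * h3 -
    (Y (e 2) (e 3) * Y (e 3) (e 1)) * h4

end SecondaryMinor

section minimalPrimes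

open MvPolynomial

variable {K : Type*} [Field K] {n : ℕ}

theorem prinMinorIdeal_le_detIdeal (t : ℕ) : prinMinorIdeal K n t ≤ detIdeal K n t := by
  refine Ideal.span_le.2 ?_
  rintro _ ⟨s, hs, rfl⟩
  rw [← Matrix.det_submatrix_equiv_self (s.orderIsoOfFin hs).toEquiv, Matrix.submatrix_submatrix]
  exact minor_mem_detIdeal_of_eq _ _

theorem det_mem_detIdeal : (genMat K n).det ∈ detIdeal K n (n - 1) := by
  simpa using minor_mem_detIdeal (K := K) (Nat.sub_le n 1) id id

theorem detIdeal_sub_one_le_ker {R : Type*} [CommRing R] (hn : 0 < n)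
    (φ : MvPolynomial (Fin n × Fin n) K →+* R)
    (h : (φ.mapMatrix (genMat K n)).adjugate = 0) : detIdeal K n (n - 1) ≤ RingHom.ker φ := by
  obtain ⟨m, rfl⟩ := Nat.exists_eq_succ_of_ne_zero hn.ne'
  rw [Nat.succ_sub_one, detIdeal_le_iff]
  have hfac : ∀ ρ : Fin m → Fin (m + 1), ∃ (i : Fin (m + 1)) (σ : Fin m → Fin m),
      ρ = i.succAbove ∘ σ := by
    intro ρ
    obtain ⟨i, hi⟩ : ∃ i, ∀ a, ρ a ≠ i := by
      by_contra! hs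
      simpa using Fintype.card_le_of_surjective ρ hs
    choose σ hσ using fun a => Fin.exists_succAbove_eq (hi a)
    exact ⟨i, σ, funext fun a => (hσ a).symm⟩
  intro ρ κ
  obtain ⟨i, σ, rfl⟩ := hfac ρ
  obtain ⟨j, τ, rfl⟩ := hfac κ
  set A := φ.mapMatrix (genMat K (m + 1))
  have h0 : (A.submatrix i.succAbove j.succAbove).det = 0 := by
    have h1 := congrFun (congrFun h j) i
    rw [Matrix.adjugate_fin_succ_eq_det_submatrix] at h1
    rcases neg_one_pow_eq_or R (i + j : ℕ) with h2 | h2 <;> simpa [h2] using h1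
  have h1 : A.submatrix (i.succAbove ∘ σ) (j.succAbove ∘ τ) =
      (1 : Matrix (Fin m) (Fin m) R).submatrix σ id * A.submatrix i.succAbove j.succAbove *
        (1 : Matrix (Fin m) (Fin m) R).submatrix id τ := by
    ext a b
    simp [Matrix.mul_apply, Matrix.one_apply]
  rw [RingHom.mem_ker, RingHom.map_det]
  change (A.submatrix (i.succAbove ∘ σ) (j.succAbove ∘ τ)).det = 0
  rw [h1, Matrix.det_mul, Matrix.det_mul, h0, mul_zero, zero_mul]

theorem detIdeal_le_or_Qideal_le (hn : 0 < n) {p : Ideal (MvPolynomial (Fin n × Fin n) K)}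
    [p.IsPrime] (hp : prinMinorIdeal K n (n - 1) ≤ p) :
    detIdeal K n (n - 1) ≤ p ∨ Qideal K n ≤ p := by
  set φ := (algebraMap (_ ⧸ p) (FractionRing (_ ⧸ p))).comp (Ideal.Quotient.mk p)
  have hker : RingHom.ker φ = p := exists_field_ker_eq p
  rw [← hker] at hp ⊢
  set A := φ.mapMatrix (genMat K n) with hA
  have hdiag := (prinMinorIdeal_sub_one_le_ker_iff hn φ).1 hp
  by_cases hdet : A.det = 0
  swap
  · exact Or.inr (Qideal_le_ker hn φ hdiag hdet)
  by_cases hadj : A.adjugate = 0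
  · exact Or.inl (detIdeal_sub_one_le_ker hn φ hadj)
  right
  obtain ⟨B, hBA, hB, hBdiag⟩ := exists_deformation_of_adjugate_ne_zero hdet hdiag hadj
  let ψ := eval₂Hom (Polynomial.C.comp (φ.comp C)) fun q : Fin n × Fin n => B q.1 q.2
  have hψ : ψ.mapMatrix (genMat K n) = B := by
    ext i j : 2
    simp [ψ, genMat]
  have hcomp : (Polynomial.evalRingHom 0).comp ψ = φ := by
    refine MvPolynomial.ringHom_ext (fun a => by simp [ψ]) fun ⟨i, j⟩ => ?_
    simpa [ψ, hA, genMat] using congrFun (congrFun hBA i) j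
  intro f hf
  have h := Qideal_le_ker hn ψ (by rwa [hψ]) (by rwa [hψ]) hf
  rw [RingHom.mem_ker, ← hcomp, RingHom.comp_apply, RingHom.mem_ker.1 h, map_zero]

theorem not_detIdeal_le_Qideal (hn : 2 ≤ n) : ¬ detIdeal K n (n - 1) ≤ Qideal K n := by
  intro h
  have h1 := h det_mem_detIdeal
  rw [Qideal_eq_ker_invHom hn, RingHom.mem_ker, RingHom.map_det] at h1
  exact invHom_det_ne_zero hn h1

theorem hollowRelation_mem_Qideal (e : Fin 4 ↪ Fin n) :
    hollowRelation (genMat K n) e ∈ Qideal K n := by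
  have hn : 2 ≤ n := by
    have := Fintype.card_le_of_embedding e
    simp at this
    omega
  rw [Qideal_eq_ker_invHom hn, RingHom.mem_ker, hollowRelation, map_sub, map_mul, map_mul]
  simp only [map_secondaryMinor]
  exact hollowRelation_eq_zero (mul_eq_one_comm.1 unitHollowMat_mul_mapMatrix_genMat)
    unitHollowMat_diag e

/-- A matrix of corank two at which the hollow relation does not vanish. -/
def corankTwoMat (L : Type*) [Field L] {m : Type*} [DecidableEq m] (e : Fin 4 → m) : Matrix m m L :=
  Matrix.of fun i =>
    if i = e 0 ∨ i = e 2 then Pi.single (e 0) 1 + Pi.single (e 1) 1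
    else if i = e 1 ∨ i = e 3 then Pi.single (e 2) 1 + Pi.single (e 3) 1
    else Pi.single i 1

section corankTwoMat

variable {L m : Type*} [Field L] [Fintype m] [DecidableEq m] (e : Fin 4 ↪ m)

theorem adjugate_corankTwoMat : (corankTwoMat L e).adjugate = 0 := by
  ext k l
  rw [Matrix.adjugate_apply]
  by_cases h : l = e 0 ∨ l = e 2
  · refine Matrix.det_zero_of_row_eq (i := e 1) (j := e 3) (by simp) ?_
    rcases h with rfl | rfl <;> ext <;> simp [corankTwoMat, Matrix.updateRow_apply]
  · refine Matrix.det_zero_of_row_eq (i := e 0) (j := e 2) (by simp) ?_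
    push Not at h
    ext
    simp [corankTwoMat, Matrix.updateRow_apply, h.1.symm, h.2.symm]

theorem corankTwoMat_mulVec (w : m → L) (i : m) : (corankTwoMat L e *ᵥ w) i =
    if i = e 0 ∨ i = e 2 then w (e 0) + w (e 1)
    else if i = e 1 ∨ i = e 3 then w (e 2) + w (e 3) else w i := by
  simp only [corankTwoMat, mulVec, Matrix.of_apply]
  have hadd : ∀ a b : m, (Pi.single a 1 + Pi.single b 1) ⬝ᵥ w = w a + w b := fun a b => by
    rw [add_dotProduct, single_one_dotProduct, single_one_dotProduct]
  split_ifs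
  · exact hadd _ _
  · exact hadd _ _
  · exact single_one_dotProduct i w

theorem eq_zero_of_corankTwoMat_mulVec {w : m → L} {a b : Fin 4}
    (h : ∀ i, i ≠ e a → i ≠ e b → (corankTwoMat L e *ᵥ w) i = 0) (he : ∀ c, w (e c) = 0) :
    w = 0 := by
  ext i
  by_cases hi : ∀ c, i ≠ e c
  · simpa [corankTwoMat_mulVec, hi] using h i (hi a) (hi b)
  · push Not at hi
    obtain ⟨c, rfl⟩ := hi
    exact he c

theorem hollowRelation_corankTwoMat_ne_zero : hollowRelation (corankTwoMat L e) e ≠ 0 := by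
  have h3 : secondaryMinor (corankTwoMat L e) (e 3) (e 1) (e 2) (e 3) = 0 := by
    refine Matrix.det_zero_of_row_eq (i := e 0) (j := e 2) (by simp) ?_
    ext
    simp [corankTwoMat, Matrix.updateRow_apply]
  have h1 : secondaryMinor (corankTwoMat L e) (e 2) (e 3) (e 0) (e 2) ≠ 0 := by
    refine secondaryMinor_ne_zero (by simp) fun w h0 h2 hw => ?_
    have h1 := hw (e 0) (by simp) (by simp)
    have h3 := hw (e 1) (by simp) (by simp)
    simp only [corankTwoMat_mulVec, EmbeddingLike.apply_eq_iff_eq] at h1 h3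
    exact eq_zero_of_corankTwoMat_mulVec e hw fun a => by fin_cases a <;> simp_all
  have h2 : secondaryMinor (corankTwoMat L e) (e 0) (e 1) (e 1) (e 3) ≠ 0 := by
    refine secondaryMinor_ne_zero (by simp) fun w h1 h3 hw => ?_
    have h0 := hw (e 2) (by simp) (by simp)
    have h2 := hw (e 3) (by simp) (by simp)
    simp only [corankTwoMat_mulVec, EmbeddingLike.apply_eq_iff_eq] at h0 h2
    exact eq_zero_of_corankTwoMat_mulVec e hw fun a => by fin_cases a <;> simp_all
  rw [hollowRelation, h3, zero_mul, sub_zero]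
  exact mul_ne_zero h1 h2

end corankTwoMat

theorem not_Qideal_le_detIdeal (hn : 4 ≤ n) : ¬ Qideal K n ≤ detIdeal K n (n - 1) := by
  intro h
  let e : Fin 4 ↪ Fin n := Fin.castLEEmb hn
  let φ : MvPolynomial (Fin n × Fin n) K →+* K := eval fun p => corankTwoMat K e p.1 p.2
  have hφ : φ.mapMatrix (genMat K n) = corankTwoMat K e := by
    ext i j
    simp [φ, genMat]
  have h1 := detIdeal_sub_one_le_ker (by omega) φ (by rw [hφ, adjugate_corankTwoMat])
    (h (hollowRelation_mem_Qideal e))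
  rw [RingHom.mem_ker, hollowRelation, map_sub, map_mul, map_mul] at h1
  simp only [map_secondaryMinor, hφ] at h1
  exact hollowRelation_corankTwoMat_ne_zero e h1

end minimalPrimes

/-- For all `n ≥ 4`, the minimal primes of the ideal `P_{n-1}` generated by the
principal `(n-1)`-minors of the generic `n × n` matrix are exactly the determinantal
ideal `I_{n-1}` and the contracted ideal `Q_{n-1}`. -/
theorem minimalPrimes_prinMinorIdeal_sub_one (K : Type*) [Field K] [IsAlgClosed K]
    (n : ℕ) (hn : 4 ≤ n) :
    (prinMinorIdeal K n (n - 1)).minimalPrimes =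
      {detIdeal K n (n - 1), Qideal K n} := by
  have hI : (detIdeal K n (n - 1)).IsPrime := by
    obtain ⟨m, rfl⟩ := Nat.exists_eq_add_of_le' hn
    exact detIdeal_succ_isPrime (by omega)
  have hQ : (Qideal K n).IsPrime := Qideal_isPrime (by omega)
  have hle : ∀ p ∈ (prinMinorIdeal K n (n - 1)).minimalPrimes,
      p = detIdeal K n (n - 1) ∨ p = Qideal K n := by
    intro p hp
    have := hp.1.1
    rcases detIdeal_le_or_Qideal_le (by omega) hp.1.2 with h | h
    · exact Or.inl (le_antisymm (hp.2 ⟨hI, prinMinorIdeal_le_detIdeal _⟩ h) h)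
    · exact Or.inr (le_antisymm (hp.2 ⟨hQ, prinMinorIdeal_le_Qideal⟩ h) h)
  ext p
  refine ⟨hle p, ?_⟩
  rintro (rfl | rfl)
  · refine ⟨⟨hI, prinMinorIdeal_le_detIdeal _⟩, fun q hq hqI => ?_⟩
    have := hq.1
    exact (detIdeal_le_or_Qideal_le (by omega) hq.2).resolve_right
      fun h => not_Qideal_le_detIdeal hn (h.trans hqI)
  · refine ⟨⟨hQ, prinMinorIdeal_le_Qideal⟩, fun q hq hqQ => ?_⟩
    have := hq.1
    exact (detIdeal_le_or_Qideal_le (by omega) hq.2).resolve_left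
      fun h => not_detIdeal_le_Qideal (by omega) (h.trans hqQ)
end
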